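/- arXiv:2111.04234 — 5 statements merged into one kernel-verified Lean document; each statement's English description precedes it below -/
import Mathlib

section
/- Assume in addition p > r!. There exists an 𝔽_𝔩-subspace W of φ[𝔩] of codimension 1 such that every element σ of the inertia group I(P) fixes W pointwise and satisfies σ(v) − v ∈ W for all v ∈ φ[𝔩]; in other words, the image of the inertia group at (T) in Aut(φ[𝔩]), written in a suitable basis, consists only of matrices that differ from the identity matrix in the last column alone. -/
set_option synthInstance.maxHeartbeats 1000000
set_option maxHeartbeats 1000000

open Polynomial

noncomputable section

/-- `F̄`: a fixed algebraic closure of `F = 𝔽_q(T)`. -/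
abbrev Kbar (Fq : Type) [Field Fq] := AlgebraicClosure (RatFunc Fq)

/-- `φ` is (encodes) the rank-`r` Drinfeld `𝔽_q[T]`-module over `𝔽_q(T)` given by
`φ_T = T + τ^{r-1} + T^{q-1} τ^r`: it is a ring homomorphism from `A = 𝔽_q[T]` to the
additive endomorphisms of `F̄` which is `𝔽_q`-linear (the condition on `C c`) and sends
`T` to `x ↦ T·x + x^{q^{r-1}} + T^{q-1}·x^{q^r}`. -/
def IsDrinfeldPhi (Fq : Type) [Field Fq] (q r : ℕ)
    (φ : Polynomial Fq →+* AddMonoid.End (Kbar Fq)) : Prop :=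
  (∀ (c : Fq) (x : Kbar Fq),
      φ (C c) x = algebraMap (RatFunc Fq) (Kbar Fq) (RatFunc.C c) * x) ∧
  (∀ x : Kbar Fq, φ X x =
      algebraMap (RatFunc Fq) (Kbar Fq) RatFunc.X * x + x ^ q ^ (r - 1) +
        algebraMap (RatFunc Fq) (Kbar Fq) RatFunc.X ^ (q - 1) * x ^ q ^ r)

/-- The `a`-torsion `φ[a] ⊆ F̄`. -/
def phiTorsion (Fq : Type) [Field Fq] (φ : Polynomial Fq →+* AddMonoid.End (Kbar Fq))
    (a : Polynomial Fq) : Set (Kbar Fq) := {x | φ a x = 0}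

/-- `g` is an `A/(a)`-module automorphism of `φ[a]`: a bijection of `φ[a]` with itself
which is additive and commutes with the `A`-action through `φ`. -/
def IsTorsionAut (Fq : Type) [Field Fq] (φ : Polynomial Fq →+* AddMonoid.End (Kbar Fq))
    (a : Polynomial Fq) (g : Kbar Fq → Kbar Fq) : Prop :=
  Set.BijOn g (phiTorsion Fq φ a) (phiTorsion Fq φ a) ∧
  (∀ x ∈ phiTorsion Fq φ a, ∀ y ∈ phiTorsion Fq φ a, g (x + y) = g x + g y) ∧
  (∀ b : Polynomial Fq, ∀ x ∈ phiTorsion Fq φ a, g (φ b x) = φ b (g x))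

/-- `K = F(φ[a])`, the subfield of `F̄` generated over `F` by the `a`-torsion. -/
def torsionField (Fq : Type) [Field Fq] (φ : Polynomial Fq →+* AddMonoid.End (Kbar Fq))
    (a : Polynomial Fq) : IntermediateField (RatFunc Fq) (Kbar Fq) :=
  IntermediateField.adjoin (RatFunc Fq) (phiTorsion Fq φ a)

/-- `σ ∈ Gal(K/F)` lies in the inertia group `I(P)` of a prime `P` of the integral
closure `B` of `A` in `K`: `σ(P) = P` and `σ` induces the identity on `B/P`,
equivalently `σ(x) − x ∈ P` for every `x ∈ B`. -/
def InInertia (Fq : Type) [Field Fq] (φ : Polynomial Fq →+* AddMonoid.End (Kbar Fq))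
    (a : Polynomial Fq)
    (P : Ideal ↥(integralClosure (Polynomial Fq) ↥(torsionField Fq φ a)))
    (σ : ↥(torsionField Fq φ a) ≃ₐ[RatFunc Fq] ↥(torsionField Fq φ a)) : Prop :=
  ∀ x : ↥(integralClosure (Polynomial Fq) ↥(torsionField Fq φ a)),
    ∃ y ∈ P, (y : ↥(torsionField Fq φ a)) = σ x - x

/-- `ι` realizes the `𝔽_q[X]`-module `M` inside the field `K` in such a way that `X` acts as
`T + τ^s + T^{q-1} τ^{s+1}`, where `τ` is the `q`-power map and `N = q^s`. -/
structure IsDrinfeldEmbedding {Fq K M : Type*} [Field Fq] [Fintype Fq] [Field K]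
    [AddCommGroup M] [Module Fq[X] M] (κ : Fq →+* K) (T : K) (N : ℕ) (ι : M →+ K) : Prop where
  injective : Function.Injective ι
  C_smul : ∀ (c : Fq) (m : M), ι (C c • m) = κ c * ι m
  X_smul : ∀ m : M, ι ((X : Fq[X]) • m) =
    T * ι m + ι m ^ N + T ^ (Fintype.card Fq - 1) * ι m ^ (N * Fintype.card Fq)

lemma exists_valuation_sub_lt_one_of_pow_card_sub_one {Fq K Γ₀ : Type*} [Field Fq] [Fintype Fq]
    [Field K] [LinearOrderedCommGroupWithZero Γ₀] (v : Valuation K Γ₀) (κ : Fq →+* K) {z : K}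
    (hz : v (z ^ Fintype.card Fq - z) < 1) : ∃ c : Fq, v (z - κ c) < 1 := by
  have key : z ^ Fintype.card Fq - z = ∏ c : Fq, (z - κ c) := by
    have h1 : (X ^ Fintype.card Fq - X : Fq[X]) = ∏ c : Fq, (X - C c) := by
      have hm : (X ^ Fintype.card Fq - X : Fq[X]).Monic :=
        monic_X_pow_sub (by rw [degree_X]; exact_mod_cast Fintype.one_lt_card)
      have hr := FiniteField.roots_X_pow_card_sub_X Fq
      have h := prod_multiset_X_sub_C_of_monic_of_roots_card_eq hm (by
        rw [hr, FiniteField.X_pow_card_sub_X_natDegree_eq Fq Fintype.one_lt_card]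
        simp)
      rw [hr] at h
      exact h.symm
    have h2 := congrArg (eval₂ κ z) h1
    rw [eval₂_finsetProd] at h2
    simpa using h2
  by_contra! h
  rw [key, map_prod] at hz
  exact absurd hz (not_lt.2 (Finset.one_le_prod' fun c _ => h c))

namespace IsDrinfeldEmbedding

variable {Fq K M Γ₀ : Type*} [Field Fq] [Fintype Fq] [Field K] [AddCommGroup M] [Module Fq[X] M]
  [LinearOrderedCommGroupWithZero Γ₀] {κ : Fq →+* K} {T : K} {N : ℕ} {ι : M →+ K}

lemma valuation_const (v : Valuation K Γ₀) (κ : Fq →+* K) {c : Fq} (hc : c ≠ 0) :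
    v (κ c) = 1 := by
  have h : v (κ c) ^ (Fintype.card Fq - 1) = 1 := by
    rw [← map_pow, ← map_pow, FiniteField.pow_card_sub_one_eq_one c hc, map_one, map_one]
  have hq : Fintype.card Fq - 1 ≠ 0 := by
    have := Fintype.one_lt_card (α := Fq); omega
  exact (pow_eq_one_iff_left hq).1 h

lemma valuation_const_le (v : Valuation K Γ₀) (κ : Fq →+* K) (c : Fq) : v (κ c) ≤ 1 := by
  rcases eq_or_ne c 0 with rfl | hc
  · simp
  · exact (valuation_const v κ hc).le

lemma X_smul_eq (h : IsDrinfeldEmbedding κ T N ι) (m : M) : ι ((X : Fq[X]) • m) =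
    T * ι m + ι m ^ N * (1 + (T * ι m ^ N) ^ (Fintype.card Fq - 1)) := by
  obtain ⟨n, hn⟩ : ∃ n, Fintype.card Fq = n + 1 :=
    ⟨Fintype.card Fq - 1, by have := Fintype.one_lt_card (α := Fq); omega⟩
  rw [h.X_smul, hn, Nat.add_sub_cancel]
  ring

section Valuation

variable (h : IsDrinfeldEmbedding κ T N ι) (v : Valuation K Γ₀) (hN : 1 < N) (hT : v T < 1)
include h hN hT

lemma valuation_X_smul_lt {m : M} (hm0 : m ≠ 0) (hm : v (ι m) < 1) :
    v (ι ((X : Fq[X]) • m)) < v (ι m) := by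
  have h0 : 0 < v (ι m) := by
    rw [v.pos_iff]; exact (map_ne_zero_iff ι h.injective).2 hm0
  have h1 : v (ι m) ^ N < v (ι m) := pow_lt_self_of_lt_one₀ h0 hm hN
  rw [h.X_smul_eq]
  refine v.map_add_lt ?_ ?_
  · rw [map_mul]; exact mul_lt_of_lt_one_left h0 hT
  · rw [map_mul, map_pow]
    refine lt_of_le_of_lt (mul_le_of_le_one_right' ?_) h1
    refine v.map_add_le (by simp) ?_
    rw [map_pow, map_mul, map_pow]
    exact pow_le_one' (mul_le_one' hT.le (pow_le_one' hm.le _)) _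

lemma valuation_X_smul_le {m : M} (hm : v (ι m) ≤ 1) :
    v (ι ((X : Fq[X]) • m)) ≤ v (ι m) := by
  have h1 : v (ι m) ^ N ≤ v (ι m) := pow_le_of_le_one zero_le hm (by omega)
  rw [h.X_smul_eq]
  refine v.map_add_le ?_ ?_
  · rw [map_mul]; exact mul_le_of_le_one_left' hT.le
  · rw [map_mul, map_pow]
    refine le_trans (mul_le_of_le_one_right' ?_) h1
    refine v.map_add_le (by simp) ?_
    rw [map_pow, map_mul, map_pow]
    exact pow_le_one' (mul_le_one' hT.le (pow_le_one' hm _)) _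

lemma valuation_smul_le {m : M} (hm : v (ι m) ≤ 1) (b : Fq[X]) :
    v (ι (b • m)) ≤ v (ι m) := by
  induction b using Polynomial.induction_on' with
  | add f g hf hg =>
    rw [add_smul, map_add]
    exact v.map_add_le hf hg
  | monomial n a =>
    rw [← C_mul_X_pow_eq_monomial, mul_smul, h.C_smul, map_mul]
    refine le_trans (mul_le_of_le_one_left' (valuation_const_le v κ a)) ?_
    induction n with
    | zero => simp
    | succ n ih =>
      rw [pow_succ', mul_smul]
      exact (h.valuation_X_smul_le v hN hT (ih.trans hm)).trans ih

lemma eq_zero_of_smul_eq_zero {l : Fq[X]} (hl : l.coeff 0 ≠ 0) {m : M} (hlm : l • m = 0)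
    (hm : v (ι m) < 1) : m = 0 := by
  by_contra hm0
  have h1 := h.valuation_X_smul_lt v hN hT hm0 hm
  have h2 := h.valuation_smul_le v hN hT (h1.le.trans hm.le) l.divX
  rw [← divX_mul_X_add l, add_smul, mul_smul] at hlm
  have h3 : v (ι (l.divX • (X : Fq[X]) • m)) < v (ι (C (l.coeff 0) • m)) := by
    rw [h.C_smul, map_mul, valuation_const v κ hl, one_mul]
    exact h2.trans_lt h1
  rw [add_eq_zero_iff_eq_neg.1 hlm, map_neg, Valuation.map_neg] at h3
  exact lt_irrefl _ h3

/-- The submodule of integral elements. -/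
def integralSubmodule : Submodule Fq[X] M where
  carrier := {m | v (ι m) ≤ 1}
  add_mem' {a b} ha hb := by
    change v (ι (a + b)) ≤ 1
    rw [map_add]
    exact v.map_add_le ha hb
  zero_mem' := by simp
  smul_mem' b m hm := (h.valuation_smul_le v hN hT hm b).trans hm

lemma valuation_X_smul_of_lt {m : M} (hm : 1 < v (ι m)) (hlt : v T * v (ι m) ^ N < 1) :
    v (ι ((X : Fq[X]) • m)) = v (ι m) ^ N := by
  have hq : Fintype.card Fq - 1 ≠ 0 := by
    have := Fintype.one_lt_card (α := Fq); omega
  have h1 : v (1 + (T * ι m ^ N) ^ (Fintype.card Fq - 1)) = 1 := by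
    apply v.map_one_add_of_lt
    rw [map_pow, map_mul, map_pow]
    exact pow_lt_one₀ zero_le hlt hq
  have h2 : v (ι m ^ N * (1 + (T * ι m ^ N) ^ (Fintype.card Fq - 1))) = v (ι m) ^ N := by
    rw [map_mul, h1, mul_one, map_pow]
  rw [h.X_smul_eq, v.map_add_eq_of_lt_right, h2]
  rw [h2, map_mul]
  refine lt_of_le_of_lt (mul_le_of_le_one_left' hT.le) ?_
  exact lt_self_pow₀ hm hN

variable [Finite M]

lemma valuation_T_mul_pow_le_one (m : M) : v T * v (ι m) ^ N ≤ 1 := by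
  obtain ⟨m₀, hm₀⟩ := Finite.exists_max (fun m : M => v (ι m))
  refine le_trans (mul_le_mul_right (pow_le_pow_left' (hm₀ m) N) _) ?_
  by_contra! hlt
  have hq : Fintype.card Fq - 1 ≠ 0 := by
    have := Fintype.one_lt_card (α := Fq); omega
  have hu : 1 < v (ι m₀) := by
    by_contra! hle
    exact absurd hlt (not_lt.2 (mul_le_one' hT.le (pow_le_one' hle _)))
  have h1 : 1 < v ((T * ι m₀ ^ N) ^ (Fintype.card Fq - 1)) := by
    rw [map_pow, map_mul, map_pow]
    exact one_lt_pow₀ hlt hq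
  have hu2 : v (ι m₀) < v (ι m₀) ^ N := lt_self_pow₀ hu hN
  have h2 : v (ι m₀) ^ N ≤ v (ι m₀ ^ N * (1 + (T * ι m₀ ^ N) ^ (Fintype.card Fq - 1))) := by
    rw [map_mul, v.map_add_eq_of_lt_right (by simpa using h1), map_pow]
    exact le_mul_of_one_le_right' h1.le
  have h3 : v (T * ι m₀) ≤ v (ι m₀) := by
    rw [map_mul]; exact mul_le_of_le_one_left' hT.le
  have h4 := hm₀ ((X : Fq[X]) • m₀)
  rw [h.X_smul_eq, v.map_add_eq_of_lt_right (h3.trans_lt (hu2.trans_le h2))] at h4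
  exact absurd (hu2.trans_le h2) (not_lt.2 h4)

lemma exists_level {m : M} (hm : 1 < v (ι m)) : ∃ k, v T * v (ι m) ^ N ^ (k + 1) = 1 := by
  by_contra hbad
  obtain ⟨m₀, ⟨hm₀, hbad₀⟩, hmax⟩ := Set.exists_max_image
    {m : M | 1 < v (ι m) ∧ ¬ ∃ k, v T * v (ι m) ^ N ^ (k + 1) = 1} (fun m => v (ι m))
    (Set.toFinite _) ⟨m, hm, hbad⟩
  have hlt : v T * v (ι m₀) ^ N < 1 :=
    lt_of_le_of_ne (h.valuation_T_mul_pow_le_one v hN hT m₀)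
      fun he => hbad₀ ⟨0, by simpa using he⟩
  have hX := h.valuation_X_smul_of_lt v hN hT hm₀ hlt
  have hu2 : v (ι m₀) < v (ι m₀) ^ N := lt_self_pow₀ hm₀ hN
  refine absurd (hmax ((X : Fq[X]) • m₀) ⟨hX ▸ hm₀.trans hu2, ?_⟩) (not_le.2 (hX ▸ hu2))
  rintro ⟨k, hk⟩
  refine hbad₀ ⟨k + 1, ?_⟩
  rwa [hX, ← pow_mul, ← pow_succ'] at hk

lemma valuation_one_add_lt_one {m : M} (hm : 1 < v (ι m)) (h1 : v T * v (ι m) ^ N = 1) :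
    v (1 + (T * ι m ^ N) ^ (Fintype.card Fq - 1)) < 1 := by
  have hT0 : 0 < v T := by
    rw [zero_lt_iff]; rintro h0; simp [h0] at h1
  have hle : v (ι ((X : Fq[X]) • m)) ≤ v (ι m) := by
    have h2 := h.valuation_T_mul_pow_le_one v hN hT ((X : Fq[X]) • m)
    rw [← h1] at h2
    exact le_of_pow_le_pow_left₀ (by omega) zero_le (le_of_mul_le_mul_left h2 hT0)
  have h3 : v (ι m ^ N * (1 + (T * ι m ^ N) ^ (Fintype.card Fq - 1))) ≤ v (ι m) := by
    rw [← add_sub_cancel_left (T * ι m) (ι m ^ N * _), ← h.X_smul_eq]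
    refine v.map_sub_le hle ?_
    rw [map_mul]; exact mul_le_of_le_one_left' hT.le
  rw [map_mul, map_pow] at h3
  by_contra! hge
  exact absurd ((lt_self_pow₀ hm hN).trans_le ((le_mul_of_one_le_right' hge).trans h3))
    (lt_irrefl _)

omit [Finite M] in
lemma valuation_X_pow_smul {m : M} (hm : 1 < v (ι m)) {k : ℕ}
    (hk : v T * v (ι m) ^ N ^ (k + 1) = 1) {i : ℕ} (hi : i ≤ k) :
    v (ι ((X : Fq[X]) ^ i • m)) = v (ι m) ^ N ^ i := by
  have hT0 : 0 < v T := by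
    rw [zero_lt_iff]; rintro h0; simp [h0] at hk
  induction i with
  | zero => simp
  | succ i ih =>
    have ih := ih (by omega)
    rw [pow_succ', mul_smul, h.valuation_X_smul_of_lt v hN hT, ih, ← pow_mul, ← pow_succ]
    · rw [ih]; exact one_lt_pow₀ hm (pow_ne_zero _ (by omega))
    · rw [ih, ← pow_mul, ← pow_succ, ← hk]
      exact mul_lt_mul_of_pos_left
        (pow_lt_pow_right₀ hm (Nat.pow_lt_pow_right hN (by omega))) hT0

variable {p n s : ℕ} [CharP K p] [hp : Fact p.Prime] (hNp : N = p ^ n)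
  (hNq : N = Fintype.card Fq ^ s)
include hNp hNq

lemma exists_valuation_sub_lt_of_level_one {x y : M} (hxy : v (ι x) = v (ι y))
    (hx : 1 < v (ι x)) (hk : v T * v (ι x) ^ N = 1) :
    ∃ c : Fq, v (ι (x - C c • y)) < v (ι x) := by
  have hy : 1 < v (ι y) := hxy ▸ hx
  have hT0 : T ≠ 0 := by rintro rfl; simp at hk
  have hy0 : ι y ≠ 0 := by intro h0; simp [h0] at hy
  have hqpos : 0 < Fintype.card Fq := Fintype.card_pos
  obtain ⟨d, hd⟩ : ∃ d, Fintype.card Fq = d + 1 := ⟨Fintype.card Fq - 1, by omega⟩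
  have hx1 := h.valuation_one_add_lt_one v hN hT hx hk
  have hy1 := h.valuation_one_add_lt_one v hN hT hy (hxy ▸ hk)
  have hdiff := v.map_sub_lt hx1 hy1
  rw [add_sub_add_left_eq_sub, hd, Nat.add_sub_cancel] at hdiff
  have hz1 : v (ι x / ι y) = 1 := by
    rw [map_div₀, hxy, div_self (by simpa using hy0)]
  have hz : v ((ι x / ι y) ^ N ^ 1 * (((ι x / ι y) ^ N) ^ d - 1)) < 1 := by
    rw [map_mul, map_pow, hz1, one_pow, one_mul]
    have : ((ι x / ι y) ^ N) ^ d - 1 = ((T * ι x ^ N) ^ d - (T * ι y ^ N) ^ d) /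
        (T * ι y ^ N) ^ d := by
      rw [eq_div_iff (pow_ne_zero _ (mul_ne_zero hT0 (pow_ne_zero _ hy0))), sub_mul, one_mul, ← mul_pow, div_pow]
      congr 2
      field_simp
    rw [this, map_div₀]
    have h1 : v ((T * ι y ^ N) ^ d) = 1 := by
      rw [map_pow, map_mul, map_pow, ← hxy, hk, one_pow]
    rwa [h1, div_one]
  obtain ⟨c, hc⟩ := exists_valuation_sub_lt_one_of_pow_card_sub_one v κ
    (z := (ι x / ι y) ^ N) (by
      rw [hd]
      convert hz using 2
      ring)
  refine ⟨c, ?_⟩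
  have hcN : κ c = κ c ^ N := by
    rw [← map_pow, hNq, FiniteField.pow_card_pow]
  rw [hcN, hNp, ← sub_pow_char_pow, map_pow, ← hNp] at hc
  have hc' : v (ι x / ι y - κ c) < 1 := (pow_lt_one_iff (by omega)).1 hc
  have : ι (x - C c • y) = (ι x / ι y - κ c) * ι y := by
    rw [map_sub, h.C_smul]; field_simp
  rw [this, map_mul, hxy]
  exact mul_lt_of_lt_one_left (zero_lt_one.trans hy) hc'

lemma exists_valuation_sub_lt {x y : M} (hxy : v (ι x) = v (ι y))
    (hx : 1 < v (ι x)) {k : ℕ} (hk : v T * v (ι x) ^ N ^ (k + 1) = 1) :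
    ∃ c : Fq, v (ι (x - C c • y)) < v (ι x) := by
  have hT0 : 0 < v T := by
    rw [zero_lt_iff]; rintro h0; simp [h0] at hk
  induction k generalizing x y with
  | zero =>
    exact h.exists_valuation_sub_lt_of_level_one v hN hT hNp hNq hxy hx (by simpa using hk)
  | succ k ih =>
    have hlt : v T * v (ι x) ^ N < 1 := by
      rw [← hk]
      refine mul_lt_mul_of_pos_left (pow_lt_pow_right₀ hx ?_) hT0
      calc N = N ^ 1 := (pow_one N).symm
        _ < N ^ (k + 1 + 1) := Nat.pow_lt_pow_right hN (by omega)
    have hX := h.valuation_X_smul_of_lt v hN hT hx hlt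
    have hY := h.valuation_X_smul_of_lt v hN hT (hxy ▸ hx) (hxy ▸ hlt)
    obtain ⟨c, hc⟩ := ih (x := (X : Fq[X]) • x) (y := (X : Fq[X]) • y) (by rw [hX, hY, hxy])
      (by rw [hX]; exact one_lt_pow₀ hx (by omega))
      (by rw [hX, ← pow_mul, ← pow_succ']; exact hk)
    refine ⟨c, ?_⟩
    have hle : v (ι (x - C c • y)) ≤ v (ι x) := by
      rw [map_sub, h.C_smul]
      refine v.map_sub_le le_rfl ?_
      rw [map_mul, hxy]
      exact mul_le_of_le_one_left' (valuation_const_le v κ c)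
    refine lt_of_le_of_ne hle fun he => ?_
    rw [smul_comm, ← smul_sub, h.valuation_X_smul_of_lt v hN hT (he ▸ hx) (he ▸ hlt), he, hX] at hc
    exact lt_irrefl _ hc

lemma exists_generator {g : M} (hg : 1 < v (ι g))
    (hmin : ∀ m : M, v (ι m) < v (ι g) → v (ι m) ≤ 1) (m : M) :
    ∃ b : Fq[X], v (ι (m - b • g)) ≤ 1 := by
  by_contra hbad
  obtain ⟨x, hx, hmaxx⟩ := Set.exists_min_image
    {m : M | ¬ ∃ b : Fq[X], v (ι (m - b • g)) ≤ 1} (fun m => v (ι m))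
    (Set.toFinite _) ⟨m, hbad⟩
  have hx1 : 1 < v (ι x) := by
    by_contra! hle
    exact hx ⟨0, by simpa using hle⟩
  obtain ⟨i, hi⟩ := h.exists_level v hN hT hg
  obtain ⟨k, hk⟩ := h.exists_level v hN hT hx1
  have hT0 : v T ≠ 0 := by rintro h0; simp [h0] at hk
  have hgx : v (ι g) ≤ v (ι x) := not_lt.1 fun hlt => not_le.2 hx1 (hmin x hlt)
  have heq : v (ι g) ^ N ^ (i + 1) = v (ι x) ^ N ^ (k + 1) :=
    mul_left_cancel₀ hT0 (hi.trans hk.symm)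
  have hki : k ≤ i := by
    by_contra! hlt
    have h1 : v (ι g) ^ N ^ (i + 1) < v (ι g) ^ N ^ (k + 1) :=
      pow_lt_pow_right₀ hg (Nat.pow_lt_pow_right hN (by omega))
    exact absurd (h1.trans_le (pow_le_pow_left' hgx _)) (heq ▸ lt_irrefl _)
  have hval := h.valuation_X_pow_smul v hN hT hg hi (Nat.sub_le i k)
  have hval' : v (ι x) = v (ι ((X : Fq[X]) ^ (i - k) • g)) := by
    refine (pow_left_inj₀ zero_le zero_le (n := N ^ (k + 1)) (pow_ne_zero _ (by omega))).1 ?_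
    rw [hval, ← pow_mul, ← pow_add, ← heq]
    congr 2
    omega
  obtain ⟨c, hc⟩ := h.exists_valuation_sub_lt v hN hT hNp hNq hval' hx1 hk
  have hgood : ∃ b : Fq[X], v (ι (x - C c • (X : Fq[X]) ^ (i - k) • g - b • g)) ≤ 1 := by
    by_contra hb
    exact absurd (hmaxx _ hb) (not_le.2 hc)
  obtain ⟨b, hb⟩ := hgood
  refine hx ⟨C c * X ^ (i - k) + b, ?_⟩
  rwa [add_smul, mul_smul, ← sub_sub]

omit hNq in
lemma valuation_sub_le_one_of_inertia {g : M} (hg : 1 < v (ι g))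
    (hmin : ∀ m : M, v (ι m) < v (ι g) → v (ι m) ≤ 1) {σ : K →+* K}
    (hσ : ∀ y, v y ≤ 1 → v (σ y - y) < 1) (hσT : σ T = T) {g' : M} (hg' : ι g' = σ (ι g)) :
    v (ι (g' - g)) ≤ 1 := by
  apply hmin
  obtain ⟨k, hk⟩ := h.exists_level v hN hT hg
  have hT0 : 0 < v T := by
    rw [zero_lt_iff]; rintro h0; simp [h0] at hk
  have h1 := hσ (T * ι g ^ N ^ (k + 1)) (by rw [map_mul, map_pow, hk])
  rw [map_mul, map_pow, hσT, ← mul_sub, hNp, ← pow_mul, ← sub_pow_char_pow, pow_mul, ← hNp,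
    map_mul, map_pow, ← hk, ← hg', ← map_sub] at h1
  exact lt_of_pow_lt_pow_left₀ _ zero_le (lt_of_mul_lt_mul_left h1 zero_le)

/-- If `M` is killed by an irreducible `l ≠ X` and not all of `M` is integral, the integral
submodule has index `#(A / l)`, and inertia acts unipotently with respect to it. -/
theorem integralSubmodule_spec {l : Fq[X]} (hl : Irreducible l) (hl0 : l.coeff 0 ≠ 0)
    (hlM : ∀ m : M, l • m = 0) (hne : ∃ m : M, 1 < v (ι m)) :
    Nat.card M = Fintype.card Fq ^ l.natDegree * Nat.card (h.integralSubmodule v hN hT) ∧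
    ∀ (σ : K →+* K) (f : M →ₗ[Fq[X]] M), (∀ y, v y ≤ 1 → v (σ y - y) < 1) → σ T = T →
      (∀ m, ι (f m) = σ (ι m)) →
      (∀ m ∈ h.integralSubmodule v hN hT, f m = m) ∧
        ∀ m, f m - m ∈ h.integralSubmodule v hN hT := by
  set W := h.integralSubmodule v hN hT with hW
  obtain ⟨g, hg, hgmin⟩ := Set.exists_min_image {m : M | 1 < v (ι m)} (fun m => v (ι m))
    (Set.toFinite _) hne
  have hmin : ∀ m : M, v (ι m) < v (ι g) → v (ι m) ≤ 1 := fun m hm => by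
    by_contra! h1
    exact absurd (hgmin m h1) (not_le.2 hm)
  have hgen := h.exists_generator v hN hT hNp hNq hg hmin
  refine ⟨?_, ?_⟩
  · let F : Fq[X] →ₗ[Fq[X]] M ⧸ W := W.mkQ ∘ₗ LinearMap.toSpanSingleton Fq[X] M g
    have hF : Function.Surjective F := by
      intro y
      obtain ⟨m, rfl⟩ := W.mkQ_surjective y
      obtain ⟨b, hb⟩ := hgen m
      refine ⟨b, ?_⟩
      have : m - b • g ∈ W := hb
      exact ((Submodule.Quotient.eq W).2 this).symm
    have hker : LinearMap.ker F = Ideal.span {l} := by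
      have hmax := PrincipalIdealRing.isMaximal_of_irreducible hl
      refine (hmax.eq_of_le ?_ ?_).symm
      · rw [Ideal.ne_top_iff_one]
        intro h1
        have h2 : W.mkQ ((1 : Fq[X]) • g) = 0 := h1
        rw [one_smul, Submodule.mkQ_apply, Submodule.Quotient.mk_eq_zero] at h2
        exact absurd hg (not_lt.2 h2)
      · rw [Ideal.span_singleton_le_iff_mem]
        change W.mkQ (l • g) = 0
        rw [hlM, map_zero]
    have hc1 : Nat.card (M ⧸ W) = Fintype.card Fq ^ l.natDegree := by
      rw [← Nat.card_congr (F.quotKerEquivOfSurjective hF).toEquiv, hker,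
        ← finrank_quotient_span_eq_natDegree (f := l)]
      have : Module.Finite Fq (Fq[X] ⧸ Ideal.span {l}) :=
        (AdjoinRoot.powerBasis hl.ne_zero).finite
      rw [Module.natCard_eq_pow_finrank (K := Fq), Nat.card_eq_fintype_card]
    rw [← hc1, mul_comm]
    exact Submodule.card_eq_card_quotient_mul_card W
  · intro σ f hσ hσT hf
    have hfix : ∀ m ∈ W, f m = m := by
      intro m hm
      refine sub_eq_zero.1 (h.eq_zero_of_smul_eq_zero v hN hT hl0 (hlM _) ?_)
      rw [map_sub, hf]
      exact hσ _ hm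
    refine ⟨hfix, fun m => ?_⟩
    obtain ⟨b, hb⟩ := hgen m
    have hfg : f g - g ∈ W :=
      h.valuation_sub_le_one_of_inertia v hN hT hNp hg hmin hσ hσT (hf g)
    have h1 := hfix (m - b • g) hb
    rw [map_sub, map_smul] at h1
    have : f m - m = b • (f g - g) := by
      rw [smul_sub]
      exact sub_eq_sub_iff_sub_eq_sub.1 h1
    rw [this]
    exact W.smul_mem b hfg

end Valuation

end IsDrinfeldEmbedding

lemma valuation_eval_derivative_zero_le {K Γ₀ : Type*} [Field K]
    [LinearOrderedCommGroupWithZero Γ₀] (v : Valuation K Γ₀) {f : K[X]} (hf : f.Splits)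
    (hroots : ∀ x ∈ f.roots, v x ≤ 1) : v (f.derivative.eval 0) ≤ v f.leadingCoeff := by
  classical
  rw [hf.eval_derivative, map_mul]
  refine mul_le_of_le_one_right' ?_
  have hsum : ∀ s : Multiset K, (∀ y ∈ s, v y ≤ 1) → v s.sum ≤ 1 := by
    intro s hs
    induction s using Multiset.induction_on with
    | empty => simp
    | cons a s ih =>
      rw [Multiset.sum_cons]
      exact v.map_add_le (hs a (Multiset.mem_cons_self _ _))
        (ih fun y hy => hs y (Multiset.mem_cons_of_mem hy))
  have hprod : ∀ s : Multiset K, (∀ y ∈ s, v y ≤ 1) → v s.prod ≤ 1 := by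
    intro s hs
    induction s using Multiset.induction_on with
    | empty => simp
    | cons a s ih =>
      rw [Multiset.prod_cons, map_mul]
      exact mul_le_one' (hs a (Multiset.mem_cons_self _ _))
        (ih fun y hy => hs y (Multiset.mem_cons_of_mem hy))
  refine hsum _ fun y hy => ?_
  obtain ⟨a, -, rfl⟩ := Multiset.mem_map.1 hy
  refine hprod _ fun z hz => ?_
  obtain ⟨b, hb, rfl⟩ := Multiset.mem_map.1 hz
  simpa using hroots b (Multiset.mem_of_mem_erase hb)

lemma valuation_sub_lt_one_of_mem_inertia {B K : Type*} [CommRing B] [IsDedekindDomain B]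
    [Field K] [Algebra B K] [IsFractionRing B K] (w : IsDedekindDomain.HeightOneSpectrum B)
    {σ : K →+* K}
    (hσ : ∀ b : B, ∃ y ∈ w.asIdeal, algebraMap B K y = σ (algebraMap B K b) - algebraMap B K b)
    {y : K} (hy : w.valuation K y ≤ 1) : w.valuation K (σ y - y) < 1 := by
  obtain ⟨b, ⟨s, hs⟩, hbs⟩ := w.exists_primeCompl_mul_eq_of_integer y hy
  change y * algebraMap B K s = algebraMap B K b at hbs
  obtain ⟨β, hβ, hβb⟩ := hσ b
  obtain ⟨γ, hγ, hγs⟩ := hσ s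
  have hvs : w.valuation K (algebraMap B K s) = 1 := (w.valuation_eq_one_iff_notMem).2 hs
  have hvβ := (w.valuation_lt_one_iff_mem (K := K) β).2 hβ
  have hvγ := (w.valuation_lt_one_iff_mem (K := K) γ).2 hγ
  have hvσs : w.valuation K (σ (algebraMap B K s)) = 1 := by
    rw [eq_add_of_sub_eq hγs.symm, Valuation.map_add_eq_of_lt_right _ (hvs.symm ▸ hvγ), hvs]
  have key : (σ y - y) * σ (algebraMap B K s) = algebraMap B K β - y * algebraMap B K γ := by
    rw [hβb, hγs, ← hbs, map_mul]
    ring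
  have h1 := congrArg (w.valuation K) key
  rw [map_mul, hvσs, mul_one] at h1
  rw [h1]
  refine Valuation.map_sub_lt _ hvβ ?_
  rw [map_mul]
  exact mul_lt_one_of_nonneg_of_lt_one_right hy zero_le hvγ

section Torsion

variable {Fq : Type} [Field Fq] {q r : ℕ} {φ : Fq[X] →+* AddMonoid.End (Kbar Fq)}

/-- The `l`-torsion as an additive group. -/
def Torsion (φ : Fq[X] →+* AddMonoid.End (Kbar Fq)) (l : Fq[X]) : Type :=
  ↥(AddMonoidHom.ker (φ l : Kbar Fq →+ Kbar Fq))

instance (l : Fq[X]) : AddCommGroup (Torsion φ l) :=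
  inferInstanceAs (AddCommGroup ↥(AddMonoidHom.ker (φ l : Kbar Fq →+ Kbar Fq)))

lemma phi_apply_comm (a b : Fq[X]) (x : Kbar Fq) : φ a (φ b x) = φ b (φ a x) := by
  have h : φ a * φ b = φ b * φ a := by rw [← map_mul, ← map_mul, mul_comm]
  exact DFunLike.congr_fun h x

lemma phi_mem_torsion {l : Fq[X]} (b : Fq[X]) {x : Kbar Fq} (hx : x ∈ phiTorsion Fq φ l) :
    φ b x ∈ phiTorsion Fq φ l := by
  have hx : φ l x = 0 := hx
  change φ l (φ b x) = 0
  rw [phi_apply_comm, hx, map_zero]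

instance (l : Fq[X]) : Module Fq[X] (Torsion φ l) where
  smul b x := ⟨φ b x.1, phi_mem_torsion b x.2⟩
  one_smul x := Subtype.ext (by change φ 1 x.1 = x.1; rw [map_one]; rfl)
  mul_smul a b x := Subtype.ext (by change φ (a * b) x.1 = φ a (φ b x.1); rw [map_mul]; rfl)
  smul_zero a := Subtype.ext (map_zero (φ a))
  smul_add a x y := Subtype.ext (map_add (φ a) x.1 y.1)
  add_smul a b x := Subtype.ext (by change φ (a + b) x.1 = φ a x.1 + φ b x.1; rw [map_add]; rfl)
  zero_smul x := Subtype.ext (by change φ 0 x.1 = 0; rw [map_zero]; rfl)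

/-- The polynomial of the Drinfeld module operator attached to `a` is separable, and for
non-constant `a` its leading coefficient is divisible by `T`. -/
lemma exists_torsion_polynomial {p : ℕ} [CharP Fq p] {m : ℕ} (hqp : q = p ^ m) (hq : 1 < q)
    (hr : 1 < r) (hφ : IsDrinfeldPhi Fq q r φ) (a : Fq[X]) (ha : a ≠ 0) :
    ∃ Q : (RatFunc Fq)[X], (∀ x : Kbar Fq, φ a x = aeval x Q) ∧
      derivative Q = C (algebraMap Fq[X] (RatFunc Fq) a) ∧
      Q.natDegree = q ^ (r * a.natDegree) ∧
      ∃ b : Fq[X], Q.leadingCoeff = algebraMap Fq[X] (RatFunc Fq) b ∧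
        (a.natDegree ≠ 0 → X ∣ b) := by
  have : CharP (RatFunc Fq) p := charP_of_injective_algebraMap
    (algebraMap Fq (RatFunc Fq)).injective p
  have hq0 : ((q : ℕ) : RatFunc Fq) = 0 := by
    rw [CharP.cast_eq_zero_iff (RatFunc Fq) p, hqp]
    exact dvd_pow_self p (by rintro rfl; simp [hqp] at hq)
  have hcast : ∀ i : ℕ, i ≠ 0 → ((q ^ i : ℕ) : RatFunc Fq) = 0 := fun i hi => by
    rw [Nat.cast_pow, hq0, zero_pow hi]
  let QT : (RatFunc Fq)[X] := 
    C RatFunc.X * X + X ^ q ^ (r - 1) + C (RatFunc.X ^ (q - 1)) * X ^ q ^ r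
  have hlow : (C RatFunc.X * X + X ^ q ^ (r - 1) : (RatFunc Fq)[X]).degree <
      (C (RatFunc.X ^ (q - 1)) * X ^ q ^ r : (RatFunc Fq)[X]).degree := by
    rw [degree_C_mul_X_pow _ (pow_ne_zero _ RatFunc.X_ne_zero)]
    refine (degree_add_le _ _).trans_lt (max_lt ?_ ?_)
    · refine (degree_C_mul_X_le _).trans_lt ?_
      exact_mod_cast Nat.one_lt_pow (by omega) hq
    · rw [degree_X_pow]
      exact_mod_cast Nat.pow_lt_pow_right hq (by omega)
  have hTdeg : QT.natDegree = q ^ r := by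
    refine natDegree_eq_of_degree_eq_some ?_
    rw [degree_add_eq_right_of_degree_lt hlow,
      degree_C_mul_X_pow _ (pow_ne_zero _ RatFunc.X_ne_zero)]
  have hTlc : QT.leadingCoeff = RatFunc.X ^ (q - 1) := by
    rw [leadingCoeff_add_of_degree_lt hlow, leadingCoeff_C_mul_X_pow]
  have hTder : derivative QT = C RatFunc.X := by
    simp only [QT, derivative_add, derivative_C_mul, derivative_X, derivative_X_pow,
      hcast _ (show r - 1 ≠ 0 by omega), hcast r (by omega)]
    simp
  have hTeval : ∀ x : Kbar Fq, φ X x = aeval x QT := fun x => by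
    rw [hφ.2 x]; simp [QT]
  obtain ⟨n, hn⟩ : ∃ n, a.natDegree = n := ⟨_, rfl⟩
  induction n generalizing a with
  | zero =>
    obtain ⟨c, rfl⟩ : ∃ c, a = C c := ⟨_, eq_C_of_natDegree_eq_zero hn⟩
    have hc : c ≠ 0 := by rintro rfl; simp at ha
    have hc' : RatFunc.C c ≠ 0 := by simpa using hc
    refine ⟨C (RatFunc.C c) * X, fun x => ?_, ?_, ?_, C c, ?_, ?_⟩
    · rw [hφ.1]; simp
    · simp
    · rw [natDegree_C_mul_X _ hc']; simp
    · rw [leadingCoeff_mul, leadingCoeff_C, leadingCoeff_X, mul_one]; simp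
    · simp
  | succ n ih =>
    have hd : a.divX.natDegree = n := by rw [natDegree_divX_eq_natDegree_tsub_one, hn]; rfl
    have hd0 : a.divX ≠ 0 := by
      rw [Ne, divX_eq_zero_iff]
      intro h0
      rw [h0, natDegree_C] at hn
      omega
    obtain ⟨Q, hQe, hQd, hQn, b, hQb, -⟩ := ih a.divX hd0 hd
    have hqr : 1 < q ^ r := Nat.one_lt_pow (by omega) hq
    have hQpos : 0 < q ^ (r * n) := pow_pos (by omega) _
    have hcn : (Q.comp QT).natDegree = q ^ (r * (n + 1)) := by
      rw [natDegree_comp, hQn, hTdeg, hd]; ring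
    have hlt : (C (RatFunc.C (a.coeff 0)) * X : (RatFunc Fq)[X]).degree < (Q.comp QT).degree := by
      refine (degree_C_mul_X_le _).trans_lt ?_
      have h1 : 1 < (Q.comp QT).natDegree := hcn ▸ Nat.one_lt_pow (by positivity) hq
      rw [degree_eq_natDegree (by intro h0; rw [h0] at h1; simp at h1)]
      exact_mod_cast h1
    refine ⟨Q.comp QT + C (RatFunc.C (a.coeff 0)) * X, fun x => ?_, ?_, ?_,
      b * (X ^ (q - 1)) ^ Q.natDegree, ?_, fun _ => ?_⟩
    · conv_lhs => rw [← divX_mul_X_add a, map_add, map_mul]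
      change φ a.divX (φ X x) + φ (C (a.coeff 0)) x = _
      rw [hφ.1, hQe, hTeval, map_add (aeval x) (Q.comp QT), aeval_comp]
      simp
    · conv_rhs => rw [← divX_mul_X_add a]
      rw [derivative_add, derivative_comp, hQd, hTder, C_comp, derivative_C_mul, derivative_X]
      simp only [map_add, map_mul, RatFunc.algebraMap_X, RatFunc.algebraMap_C, mul_one]
      ring
    · rw [natDegree_eq_of_degree_eq (degree_add_eq_left_of_degree_lt hlt), hcn, hn]
    · rw [leadingCoeff_add_of_degree_lt' hlt, leadingCoeff_comp (by omega), hTlc, hQb]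
      simp
    · rw [hQn, ← pow_mul]
      refine Dvd.dvd.mul_left (dvd_pow_self _ ?_) _
      have : q - 1 ≠ 0 := by omega
      have := pow_pos (show 0 < q by omega) (r * a.divX.natDegree)
      positivity

lemma phi_algEquiv_apply (hφ : ∀ b : Fq[X], ∃ R : (RatFunc Fq)[X], ∀ x, φ b x = aeval x R)
    {L : IntermediateField (RatFunc Fq) (Kbar Fq)} (σ : L ≃ₐ[RatFunc Fq] L) (b : Fq[X])
    {y z : L} (hz : (z : Kbar Fq) = φ b y) : φ b (σ y) = σ z := by
  obtain ⟨R, hR⟩ := hφ b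
  have hcoe : ∀ u : L, aeval (u : Kbar Fq) R = (aeval u R : L) := fun u =>
    aeval_algebraMap_apply (Kbar Fq) u R
  rw [hR, hcoe] at hz
  rw [hR, hcoe, Subtype.ext hz, aeval_algHom_apply σ]

lemma phiTorsion_eq_rootSet {l : Fq[X]} {Q : (RatFunc Fq)[X]} (hQ0 : Q ≠ 0)
    (hQ : ∀ x : Kbar Fq, φ l x = aeval x Q) : phiTorsion Fq φ l = Q.rootSet (Kbar Fq) := by
  ext x
  rw [mem_rootSet_of_ne hQ0, ← hQ]
  rfl

lemma isSplittingField_torsionField {l : Fq[X]} {Q : (RatFunc Fq)[X]} (hQ0 : Q ≠ 0)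
    (hQ : ∀ x : Kbar Fq, φ l x = aeval x Q) :
    IsSplittingField (RatFunc Fq) (torsionField Fq φ l) Q := by
  rw [torsionField, phiTorsion_eq_rootSet hQ0 hQ]
  exact IntermediateField.adjoin_rootSet_isSplittingField (IsAlgClosed.splits _)

/-- The inclusion of the `l`-torsion in the field it generates. -/
def Torsion.toField (φ : Fq[X] →+* AddMonoid.End (Kbar Fq)) (l : Fq[X]) :
    Torsion φ l →+ torsionField Fq φ l where
  toFun m := ⟨m.1, IntermediateField.subset_adjoin _ _ m.2⟩
  map_zero' := rfl
  map_add' _ _ := rfl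

lemma Torsion.isDrinfeldEmbedding [Fintype Fq] (hr : 1 < r)
    (hφ : IsDrinfeldPhi Fq (Fintype.card Fq) r φ) (l : Fq[X]) :
    IsDrinfeldEmbedding ((algebraMap (RatFunc Fq) (torsionField Fq φ l)).comp RatFunc.C)
      (algebraMap (RatFunc Fq) (torsionField Fq φ l) RatFunc.X) (Fintype.card Fq ^ (r - 1))
      (Torsion.toField φ l) where
  injective m n hmn := Subtype.ext (congrArg (fun y : torsionField Fq φ l => (y : Kbar Fq)) hmn)
  C_smul c m := Subtype.ext (hφ.1 c m.1)
  X_smul m := by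
    rw [← pow_succ, Nat.sub_add_cancel hr.le]
    exact Subtype.ext (hφ.2 m.1)

/-- The endomorphism of the `l`-torsion induced by an automorphism of the field it generates. -/
def Torsion.galoisMap (hφ : ∀ b : Fq[X], ∃ R : (RatFunc Fq)[X], ∀ x, φ b x = aeval x R)
    {l : Fq[X]} (σ : torsionField Fq φ l ≃ₐ[RatFunc Fq] torsionField Fq φ l) :
    Torsion φ l →ₗ[Fq[X]] Torsion φ l where
  toFun m := ⟨(σ (Torsion.toField φ l m) : torsionField Fq φ l), by
    have h : φ l m.1 = 0 := m.2
    change φ l _ = 0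
    rw [phi_algEquiv_apply hφ σ l (z := 0) h.symm, map_zero]
    rfl⟩
  map_add' m n := Subtype.ext (congrArg (fun y : torsionField Fq φ l => (y : Kbar Fq))
    ((congrArg σ (map_add (Torsion.toField φ l) m n)).trans (map_add σ _ _)))
  map_smul' b m := Subtype.ext
    (phi_algEquiv_apply hφ σ b (y := Torsion.toField φ l m)
      (z := Torsion.toField φ l (b • m)) rfl).symm

end Torsion

/-- Assume `p > r!`. For `𝔩 = (l) ≠ (T)` and `P` a prime of the integral closure `B` of
`A` in `K = F(φ[𝔩])` lying over `(T)`, there is an `𝔽_𝔩`-subspace `W ⊆ φ[𝔩]` of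
codimension `1` (i.e. with `|𝔽_𝔩|^{r−1}` elements) such that every `σ ∈ I(P)` fixes `W`
pointwise and satisfies `σ(v) − v ∈ W` for all `v ∈ φ[𝔩]`. -/
theorem inertia_at_T_unipotent_last_column
    (p e q r : ℕ) (hp : p.Prime) (hp5 : 5 ≤ p) (he : 0 < e) (hq : q = p ^ e)
    (hr : r.Prime) (hr3 : 3 ≤ r) (hfac : r.factorial < p)
    (Fq : Type) [Field Fq] [Fintype Fq] (hFq : Fintype.card Fq = q)
    (φ : Polynomial Fq →+* AddMonoid.End (Kbar Fq)) (hφ : IsDrinfeldPhi Fq q r φ)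
    (l : Polynomial Fq) (hlm : l.Monic) (hl : Irreducible l) (hlX : l ≠ X)
    (P : Ideal ↥(integralClosure (Polynomial Fq) ↥(torsionField Fq φ l)))
    (hP : P.IsPrime)
    (hPT : P.comap (algebraMap (Polynomial Fq)
        ↥(integralClosure (Polynomial Fq) ↥(torsionField Fq φ l))) =
      Ideal.span {(X : Polynomial Fq)}) :
    ∃ W : Set (Kbar Fq), W ⊆ phiTorsion Fq φ l ∧ (0 : Kbar Fq) ∈ W ∧
      (∀ x ∈ W, ∀ y ∈ W, x + y ∈ W) ∧
      (∀ b : Polynomial Fq, ∀ x ∈ W, φ b x ∈ W) ∧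
      Nat.card W = (q ^ l.natDegree) ^ (r - 1) ∧
      ∀ σ : ↥(torsionField Fq φ l) ≃ₐ[RatFunc Fq] ↥(torsionField Fq φ l),
        InInertia Fq φ l P σ →
        (∀ x, ∀ hx : x ∈ phiTorsion Fq φ l, x ∈ W →
          ((σ ⟨x, IntermediateField.subset_adjoin _ _ hx⟩ : ↥(torsionField Fq φ l)) :
            Kbar Fq) = x) ∧
        (∀ x, ∀ hx : x ∈ phiTorsion Fq φ l,
          ((σ ⟨x, IntermediateField.subset_adjoin _ _ hx⟩ : ↥(torsionField Fq φ l)) :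
            Kbar Fq) - x ∈ W) := by
  have : Fact p.Prime := ⟨hp⟩
  subst hFq
  have : CharP Fq p := charP_of_card_eq_prime_pow (f := e) (by rw [← hq])
  have hq1 : 1 < Fintype.card Fq := Fintype.one_lt_card
  have hr1 : 1 < r := by omega
  have hl0 : l.coeff 0 ≠ 0 := fun h0 => hlX
    (eq_of_monic_of_associated hlm monic_X
      ((irreducible_X.associated_of_dvd hl (X_dvd_iff.2 h0)).symm))
  have hXl : ¬ X ∣ l := fun h => hl0 (X_dvd_iff.1 h)
  have hpoly := exists_torsion_polynomial hq hq1 hr1 hφ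
  have hpoly' : ∀ b : Fq[X], ∃ R : (RatFunc Fq)[X], ∀ x, φ b x = aeval x R := fun b => by
    rcases eq_or_ne b 0 with rfl | hb
    · exact ⟨0, fun x => by rw [map_zero, map_zero]; rfl⟩
    · obtain ⟨R, hR, -⟩ := hpoly b hb
      exact ⟨R, hR⟩
  obtain ⟨Q, hQ, hQd, hQn, b, hQb, hXb⟩ := hpoly l hl.ne_zero
  have hlF : algebraMap Fq[X] (RatFunc Fq) l ≠ 0 := by simpa using hl.ne_zero
  have hQ0 : Q ≠ 0 := by
    rintro rfl
    rw [derivative_zero] at hQd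
    exact hlF (C_eq_zero.1 hQd.symm)
  have hsep : Q.Separable := by
    rw [separable_def, hQd]
    exact isCoprime_one_right.of_isCoprime_of_dvd_right
      (isUnit_C.2 hlF.isUnit).dvd
  have := isSplittingField_torsionField hQ0 hQ
  have : FiniteDimensional (RatFunc Fq) (torsionField Fq φ l) :=
    IsSplittingField.finiteDimensional _ Q
  have : IsGalois (RatFunc Fq) (torsionField Fq φ l) :=
    IsGalois.of_separable_splitting_field hsep
  have : IsDedekindDomain (integralClosure Fq[X] (torsionField Fq φ l)) :=
    integralClosure.isDedekindDomain Fq[X] (RatFunc Fq) (torsionField Fq φ l)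
  have : IsFractionRing (integralClosure Fq[X] (torsionField Fq φ l)) (torsionField Fq φ l) :=
    integralClosure.isFractionRing_of_finite_extension (RatFunc Fq) (torsionField Fq φ l)
  have hmemP : ∀ a : Fq[X], algebraMap Fq[X]
      (integralClosure Fq[X] (torsionField Fq φ l)) a ∈ P ↔ X ∣ a := fun a => by
    rw [← Ideal.mem_comap, hPT, Ideal.mem_span_singleton]
  have hP0 : P ≠ ⊥ := by
    rintro rfl
    have h1 := (hmemP X).2 dvd_rfl
    rw [Ideal.mem_bot] at h1
    have h2 : algebraMap (RatFunc Fq) (torsionField Fq φ l)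
        (algebraMap Fq[X] (RatFunc Fq) X) = 0 := by
      rw [← IsScalarTower.algebraMap_apply]
      exact congrArg Subtype.val h1
    rw [map_eq_zero, RatFunc.algebraMap_X] at h2
    exact RatFunc.X_ne_zero h2
  let w : IsDedekindDomain.HeightOneSpectrum
    (integralClosure Fq[X] (torsionField Fq φ l)) := ⟨P, hP, hP0⟩
  let v := w.valuation (torsionField Fq φ l)
  have hvP : ∀ a : Fq[X], v (algebraMap (RatFunc Fq) (torsionField Fq φ l)
      (algebraMap Fq[X] (RatFunc Fq) a)) < 1 ↔ X ∣ a := fun a => by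
    rw [← hmemP, ← IsScalarTower.algebraMap_apply, IsScalarTower.algebraMap_apply Fq[X]
      (integralClosure Fq[X] (torsionField Fq φ l))]
    exact w.valuation_lt_one_iff_mem _
  have hT : v (algebraMap (RatFunc Fq) (torsionField Fq φ l) RatFunc.X) < 1 := by
    rw [← RatFunc.algebraMap_X]
    exact (hvP X).2 dvd_rfl
  have hemb := Torsion.isDrinfeldEmbedding hr1 hφ l
  have hN : 1 < Fintype.card Fq ^ (r - 1) := Nat.one_lt_pow (by omega) hq1
  have : CharP (torsionField Fq φ l) p := charP_of_injective_ringHom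
    ((algebraMap (RatFunc Fq) (torsionField Fq φ l)).comp RatFunc.C).injective p
  have hcard : Nat.card (Torsion φ l) = Fintype.card Fq ^ (r * l.natDegree) := by
    change Nat.card (phiTorsion Fq φ l) = _
    rw [phiTorsion_eq_rootSet hQ0 hQ, Nat.card_eq_fintype_card,
      card_rootSet_eq_natDegree hsep (IsAlgClosed.splits _), hQn]
  have : Finite (Torsion φ l) := Nat.finite_of_card_ne_zero (by rw [hcard]; positivity)
  have hne : ∃ m : Torsion φ l, 1 < v (Torsion.toField φ l m) := by
    by_contra! hall
    have h1 := valuation_eval_derivative_zero_le v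
      (IsSplittingField.splits (torsionField Fq φ l) Q) (fun x hx => by
        have hx' : aeval x Q = 0 := by
          rw [aeval_def, ← eval_map]
          exact (mem_roots'.1 hx).2
        refine hall ⟨x, ?_⟩
        change φ l x = 0
        rw [hQ]
        exact (aeval_algebraMap_apply (Kbar Fq) x Q).trans (by rw [hx', map_zero]))
    rw [derivative_map, hQd, map_C, eval_C, leadingCoeff_map, hQb] at h1
    exact hXl ((hvP l).1 (h1.trans_lt ((hvP b).2 (hXb hl.natDegree_pos.ne'))))
  obtain ⟨hc, hσ⟩ := hemb.integralSubmodule_spec v hN hT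
    (p := p) (n := e * (r - 1)) (s := r - 1) (by rw [hq, pow_mul]) rfl hl hl0
    (fun m => Subtype.ext m.2) hne
  set W := hemb.integralSubmodule v hN hT
  refine ⟨(fun m : Torsion φ l => m.1) '' {m | m ∈ W}, ?_, ?_, ?_, ?_, ?_, fun σ hin => ?_⟩
  · rintro _ ⟨m, -, rfl⟩
    exact m.2
  · exact ⟨0, W.zero_mem, rfl⟩
  · rintro _ ⟨m, hm, rfl⟩ _ ⟨n, hn, rfl⟩
    exact ⟨m + n, W.add_mem hm hn, rfl⟩
  · rintro b _ ⟨(m : Torsion φ l), hm, rfl⟩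
    exact ⟨(b • m : Torsion φ l), W.smul_mem b hm, rfl⟩
  · refine (Nat.card_image_of_injective (f := fun m : Torsion φ l => m.1)
      Subtype.val_injective _).trans ?_
    refine Nat.eq_of_mul_eq_mul_left (pow_pos (by omega : 0 < Fintype.card Fq) l.natDegree)
      (hc.symm.trans ?_)
    rw [hcard, ← pow_mul, ← pow_add]
    congr 1
    obtain ⟨k, rfl⟩ : ∃ k, r = k + 1 := ⟨r - 1, by omega⟩
    rw [Nat.add_sub_cancel]
    ring
  · obtain ⟨hfix, hsub⟩ := hσ (σ : torsionField Fq φ l →+* torsionField Fq φ l)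
      (Torsion.galoisMap hpoly' σ)
      (fun y hy => valuation_sub_lt_one_of_mem_inertia w
        (σ := (σ : torsionField Fq φ l →+* torsionField Fq φ l)) hin hy)
      (σ.commutes _) (fun m => rfl)
    refine ⟨?_, fun x hx => ⟨_, hsub ⟨x, hx⟩, rfl⟩⟩
    rintro _ hx ⟨m, hm, rfl⟩
    exact congrArg Subtype.val (hfix m hm)
end
end

section
/- Assume in addition p > r!. The inertia group I(P) has order exactly |𝔽_𝔩|^{r−1} = q^{(r−1)·deg(l)}; equivalently, the ramification index of P over the prime (T) in the extension K/F equals q^{(r−1)·deg(l)}. -/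
set_option synthInstance.maxHeartbeats 1000000
set_option maxHeartbeats 1000000

open Polynomial

noncomputable section

lemma finite_mem_and {α S : Type*} [SetLike S α] (M : S) [Finite M] (P : α → Prop) :
    Finite {z : α // z ∈ M ∧ P z} :=
  ((Set.toFinite (M : Set α)).subset fun _ hz ↦ hz.1 : {z | z ∈ M ∧ P z}.Finite)

section Operator

variable (k : Type*) [Field k] [Fintype k] {K : Type*} [Field K] [Algebra k K]

/-- The `k`-linear operator `x ↦ T x + x ^ q ^ s + T ^ (q - 1) x ^ q ^ (s + 1)` with `q = #k`. -/
def drinfeldOp (T : K) (s : ℕ) : Module.End k K :=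
  LinearMap.mulLeft k T + (FiniteField.frobeniusAlgHom k K ^ s).toLinearMap +
    LinearMap.mulLeft k (T ^ (Fintype.card k - 1)) ∘ₗ
      (FiniteField.frobeniusAlgHom k K ^ (s + 1)).toLinearMap

lemma frobeniusAlgHom_pow_apply (s : ℕ) (x : K) :
    (FiniteField.frobeniusAlgHom k K ^ s) x = x ^ Fintype.card k ^ s := by
  rw [AlgHom.coe_pow, FiniteField.coe_frobeniusAlgHom, pow_iterate]

lemma drinfeldOp_apply (T : K) (s : ℕ) (x : K) :
    drinfeldOp k T s x = T * x + x ^ Fintype.card k ^ s +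
      T ^ (Fintype.card k - 1) * x ^ Fintype.card k ^ (s + 1) := by
  simp only [drinfeldOp, LinearMap.add_apply, LinearMap.comp_apply, LinearMap.mulLeft_apply,
    AlgHom.toLinearMap_apply, frobeniusAlgHom_pow_apply]

lemma sub_pow_card_pow (s : ℕ) (x y : K) :
    (x - y) ^ Fintype.card k ^ s = x ^ Fintype.card k ^ s - y ^ Fintype.card k ^ s := by
  simp only [← frobeniusAlgHom_pow_apply, map_sub]

lemma prod_sub_algebraMap_eq (u : K) :
    ∏ a : k, (u - algebraMap k K a) = u ^ Fintype.card k - u := by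
  have hX : (∏ a : k, (X - C a)) = (X ^ Fintype.card k - X : k[X]) := by
    have h := prod_multiset_X_sub_C_of_monic_of_roots_card_eq
      (p := (X ^ Fintype.card k - X : k[X]))
      (monic_X_pow_sub (by rw [degree_X]; exact_mod_cast Fintype.one_lt_card))
      (by rw [FiniteField.roots_X_pow_card_sub_X,
            FiniteField.X_pow_card_sub_X_natDegree_eq _ Fintype.one_lt_card]; rfl)
    rwa [FiniteField.roots_X_pow_card_sub_X] at h
  simpa [map_prod] using congrArg (aeval u) hX

/-- The kernel of `l` acting through `drinfeldOp`. -/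
def opTorsion (T : K) (s : ℕ) (l : k[X]) : Submodule k K :=
  LinearMap.ker (aeval (drinfeldOp k T s) l)

variable {k}

lemma mem_opTorsion {T : K} {s : ℕ} {l : k[X]} {x : K} :
    x ∈ opTorsion k T s l ↔ aeval (drinfeldOp k T s) l x = 0 := Iff.rfl

lemma aeval_mem_opTorsion {T : K} {s : ℕ} {l : k[X]} {x : K} (b : k[X])
    (hx : x ∈ opTorsion k T s l) : aeval (drinfeldOp k T s) b x ∈ opTorsion k T s l := by
  rw [mem_opTorsion] at hx ⊢
  rw [← Module.End.mul_apply, ← map_mul, mul_comm, map_mul, Module.End.mul_apply, hx, map_zero]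

lemma drinfeldOp_mem_opTorsion {T : K} {s : ℕ} {l : k[X]} {x : K}
    (hx : x ∈ opTorsion k T s l) : drinfeldOp k T s x ∈ opTorsion k T s l := by
  simpa using aeval_mem_opTorsion X hx

lemma aeval_drinfeldOp_eq_sum (T : K) (s : ℕ) (l : k[X]) (x : K) :
    aeval (drinfeldOp k T s) l x =
      ∑ i ∈ Finset.range (l.natDegree + 1), l.coeff i • (drinfeldOp k T s ^ i) x := by
  simp [aeval_eq_sum_range]

end Operator

section Valuation

variable {k : Type*} [Field k] [Fintype k] {K : Type*} [Field K] [Algebra k K]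
  {Γ : Type*} [LinearOrderedCommGroupWithZero Γ] (v : Valuation K Γ)

lemma Valuation.map_algebraMap_of_ne_zero {a : k} (ha : a ≠ 0) : v (algebraMap k K a) = 1 := by
  have h : v (algebraMap k K a) ^ (Fintype.card k - 1) = 1 := by
    rw [← map_pow, ← map_pow, FiniteField.pow_card_sub_one_eq_one a ha, map_one, map_one]
  exact (pow_eq_one_iff_of_nonneg zero_le (Nat.sub_pos_of_lt Fintype.one_lt_card).ne').1 h

lemma Valuation.map_smul_le (a : k) (x : K) : v (a • x) ≤ v x := by
  rcases eq_or_ne a 0 with rfl | ha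
  · simp
  · rw [Algebra.smul_def, map_mul, v.map_algebraMap_of_ne_zero ha, one_mul]

variable {v} {T : K} {s : ℕ}

local notation "D" => drinfeldOp k T s
local notation "q" => Fintype.card k

lemma one_lt_card_pow (hs : s ≠ 0) : 1 < q ^ s := Nat.one_lt_pow hs Fintype.one_lt_card

lemma one_lt_of_one_lt_mul_pow {a b : Γ} (ha : a < 1) {n : ℕ} (h : 1 ≤ a * b ^ n) : 1 < b := by
  by_contra! hb
  have : a * b ^ n < 1 :=
    lt_of_le_of_lt (mul_le_of_le_one_right' (pow_le_one₀ zero_le hb)) ha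
  exact absurd h this.not_ge

omit [Algebra k K] in
lemma val_third_term (x : K) :
    v (T ^ (q - 1) * x ^ q ^ (s + 1)) = v x ^ q ^ s * (v T * v x ^ q ^ s) ^ (q - 1) := by
  have hq : q = (q - 1) + 1 := (Nat.succ_pred_eq_of_pos Fintype.card_pos).symm
  have : v x ^ q ^ (s + 1) = v x ^ q ^ s * (v x ^ q ^ s) ^ (q - 1) := by
    rw [← pow_succ', ← hq, ← pow_mul, pow_succ]
  rw [map_mul, map_pow, map_pow, this, mul_pow]
  exact mul_left_comm _ _ _

lemma lt_val_drinfeldOp (hs : s ≠ 0) (hT : v T < 1) {x : K} (hx : 1 < v T * v x ^ q ^ s) :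
    v x < v (D x) := by
  have h1 : 1 < v x := one_lt_of_one_lt_mul_pow hT hx.le
  have hx' : v x ≤ v x ^ q ^ s := le_self_pow₀ h1.le (one_lt_card_pow hs).ne_bot
  have hpos : 0 < v x ^ q ^ s := pow_pos (zero_lt_one.trans h1) _
  have h3 : v x ^ q ^ s < v (T ^ (q - 1) * x ^ q ^ (s + 1)) := by
    rw [val_third_term]
    refine lt_mul_of_one_lt_right hpos (one_lt_pow₀ hx ?_)
    exact (Nat.sub_pos_of_lt Fintype.one_lt_card).ne'
  rw [drinfeldOp_apply, v.map_add_eq_of_lt_right]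
  · exact hx'.trans_lt h3
  · refine lt_of_le_of_lt (v.map_add_le ?_ (v.map_pow _ _).le) h3
    rw [map_mul]
    exact (mul_le_of_le_one_left' hT.le).trans hx'

lemma val_drinfeldOp_of_lt (hs : s ≠ 0) (hT : v T < 1) {x : K} (h1 : 1 < v x)
    (hx : v T * v x ^ q ^ s < 1) : v (D x) = v x ^ q ^ s := by
  have hx' : v x ≤ v x ^ q ^ s := le_self_pow₀ h1.le (one_lt_card_pow hs).ne_bot
  have hpos : 0 < v x ^ q ^ s := pow_pos (zero_lt_one.trans h1) _
  have h2 : v (T * x + x ^ q ^ s) = v x ^ q ^ s := by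
    rw [v.map_add_eq_of_lt_right, map_pow]
    rw [map_mul, map_pow]
    exact (mul_lt_of_lt_one_left (zero_lt_one.trans h1) hT).trans_le hx'
  rw [drinfeldOp_apply, v.map_add_eq_of_lt_left, h2]
  rw [h2, val_third_term]
  exact mul_lt_of_lt_one_right hpos
    (pow_lt_one₀ zero_le hx (Nat.sub_pos_of_lt Fintype.one_lt_card).ne')

lemma val_drinfeldOp_sub_le (hs : s ≠ 0) (hT : v T < 1) {x : K} (h1 : v x ≤ 1) :
    v (D x - T * x) ≤ v x ^ 2 := by
  have h (n : ℕ) (hn : 2 ≤ n) : v x ^ n ≤ v x ^ 2 := pow_le_pow_right_of_le_one' h1 hn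
  rw [drinfeldOp_apply, add_assoc, add_sub_cancel_left]
  refine v.map_add_le ?_ ?_
  · rw [map_pow]; exact h _ (one_lt_card_pow hs)
  · rw [map_mul, map_pow, map_pow]
    exact (mul_le_of_le_one_left' (pow_le_one₀ zero_le hT.le)).trans
      (h _ (one_lt_card_pow (by omega)))

lemma val_drinfeldOp_le (hs : s ≠ 0) (hT : v T < 1) {x : K} (h1 : v x ≤ 1) :
    v (D x) ≤ v x := by
  have := v.map_add_le ((val_drinfeldOp_sub_le (k := k) hs hT h1).trans
    (pow_le_of_le_one zero_le h1 two_ne_zero))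
    ((v.map_mul T x).le.trans (mul_le_of_le_one_left' hT.le))
  rwa [sub_add_cancel] at this

lemma val_drinfeldOp_pow_le (hs : s ≠ 0) (hT : v T < 1) {x : K} (h1 : v x ≤ 1) (i : ℕ) :
    v ((D ^ i) x) ≤ v x := by
  induction i with
  | zero => simp
  | succ i ih =>
    rw [pow_succ', Module.End.mul_apply]
    exact (val_drinfeldOp_le hs hT (ih.trans h1)).trans ih

lemma val_drinfeldOp_pow_sub_le (hs : s ≠ 0) (hT : v T < 1) {x : K} (h1 : v x ≤ 1) (i : ℕ) :
    v ((D ^ i) x - T ^ i * x) ≤ v x ^ 2 := by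
  induction i with
  | zero => simp
  | succ i ih =>
    have h := val_drinfeldOp_pow_le (k := k) hs hT h1 i
    have h2 : v (T * ((D ^ i) x - T ^ i * x)) ≤ v x ^ 2 := by
      rw [map_mul]; exact (mul_le_of_le_one_left' hT.le).trans ih
    have h3 := v.map_add_le ((val_drinfeldOp_sub_le (k := k) hs hT (h.trans h1)).trans
      (pow_le_pow_left₀ zero_le h 2)) h2
    rw [pow_succ', Module.End.mul_apply]
    convert h3 using 2
    ring

/-- Torsion points prime to `T` reduce injectively. -/
lemma eq_zero_of_mem_opTorsion (hs : s ≠ 0) (hT : v T < 1) {l : k[X]} (hl : v (aeval T l) = 1)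
    {x : K} (hx : x ∈ opTorsion k T s l) (h1 : v x < 1) : x = 0 := by
  by_contra h0
  have hpos : 0 < v x := (v.pos_iff).2 h0
  have h2 : v (aeval T l * x) ≤ v x ^ 2 := by
    have : aeval T l * x = -∑ i ∈ Finset.range (l.natDegree + 1),
        l.coeff i • ((D ^ i) x - T ^ i * x) := by
      rw [mem_opTorsion, aeval_drinfeldOp_eq_sum] at hx
      simp_rw [smul_sub, Finset.sum_sub_distrib, hx, aeval_eq_sum_range, Finset.sum_mul,
        smul_mul_assoc]
      simp
    rw [this, Valuation.map_neg]
    exact v.map_sum_le fun i _ ↦ (v.map_smul_le _ _).trans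
      (val_drinfeldOp_pow_sub_le hs hT h1.le i)
  rw [map_mul, hl, one_mul] at h2
  have : v x ^ 2 < v x := by
    rw [sq]; exact mul_lt_of_lt_one_left hpos h1
  exact absurd h2 this.not_ge

lemma val_drinfeldOp_pow_sub_pow_lt (hs : s ≠ 0) (hT : v T < 1) {x : K} (h1 : v x ≤ 1) (i : ℕ) :
    v ((D ^ i) x - x ^ q ^ (s * i)) < 1 := by
  induction i with
  | zero => simp
  | succ i ih =>
    set y := (D ^ i) x with hy
    have hy1 : v y ≤ 1 := (val_drinfeldOp_pow_le hs hT h1 i).trans h1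
    have h2 : v (D y - y ^ q ^ s) < 1 := by
      have : D y - y ^ q ^ s = T * y + T ^ (q - 1) * y ^ q ^ (s + 1) := by
        rw [drinfeldOp_apply]; ring
      rw [this]
      refine v.map_add_lt ?_ ?_
      · rw [map_mul]; exact (mul_le_of_le_one_right' hy1).trans_lt hT
      · rw [map_mul, map_pow, map_pow]
        exact (mul_le_of_le_one_right' (pow_le_one₀ zero_le hy1)).trans_lt
          (pow_lt_one₀ zero_le hT (Nat.sub_pos_of_lt Fintype.one_lt_card).ne')
    have h3 : v (y ^ q ^ s - x ^ q ^ (s * (i + 1))) < 1 := by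
      have : y ^ q ^ s - x ^ q ^ (s * (i + 1)) = (y - x ^ q ^ (s * i)) ^ q ^ s := by
        rw [sub_pow_card_pow, ← pow_mul, mul_add, mul_one, pow_add]
      rw [this, map_pow]
      exact pow_lt_one₀ zero_le ih (one_lt_card_pow hs).ne_bot
    rw [pow_succ', Module.End.mul_apply]
    simpa using v.map_add_lt h2 h3

lemma val_one_add_lt (hs : s ≠ 0) (hT : v T < 1) {x : K} (hx : v T * v x ^ q ^ s = 1)
    (hDx : v T * v (D x) ^ q ^ s ≤ 1) : v (1 + (T * x ^ q ^ s) ^ (q - 1)) < 1 := by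
  have h1 : 1 < v x := one_lt_of_one_lt_mul_pow hT hx.ge
  have hT0 : 0 < v T := by
    rw [zero_lt_iff]; rintro h; simp [h] at hx
  have hQ := one_lt_card_pow (k := k) hs
  have hpos : 0 < v x ^ q ^ s := pow_pos (zero_lt_one.trans h1) _
  have hx' : v x ≤ v x ^ q ^ s := le_self_pow₀ h1.le hQ.ne_bot
  have h2 : v (D x) < v x ^ q ^ s := by
    by_contra! h
    have h3 : v x ^ q ^ s < (v x ^ q ^ s) ^ q ^ s :=
      lt_self_pow₀ (one_lt_pow₀ h1 hQ.ne_bot) hQ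
    have h4 := h3.trans_le (pow_le_pow_left₀ zero_le h (q ^ s))
    have h5 := mul_lt_mul_of_pos_left h4 hT0
    rw [hx] at h5
    exact h5.not_ge hDx
  have h3 : v (D x - T * x) < v x ^ q ^ s := by
    refine v.map_sub_lt h2 ?_
    rw [map_mul]
    exact (mul_lt_of_lt_one_left (zero_lt_one.trans h1) hT).trans_le hx'
  have h4 : D x - T * x = x ^ q ^ s * (1 + (T * x ^ q ^ s) ^ (q - 1)) := by
    have hq : q = (q - 1) + 1 := (Nat.succ_pred_eq_of_pos Fintype.card_pos).symm
    have : x ^ q ^ (s + 1) = x ^ q ^ s * (x ^ q ^ s) ^ (q - 1) := by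
      rw [← pow_succ', ← hq, ← pow_mul, pow_succ]
    rw [drinfeldOp_apply, this, mul_pow]
    ring
  rw [h4, map_mul, map_pow] at h3
  exact (mul_lt_iff_lt_one_right hpos).1 h3

lemma exists_val_sub_smul_lt_one {u : K} (hu : v u = 1)
    (h : v (u ^ (q ^ s * (q - 1)) - 1) < 1) : ∃ a : k, v (u - algebraMap k K a) < 1 := by
  have h1 : v (u ^ q - u) ^ q ^ s < 1 := by
    have hq : q * q ^ s = q ^ s + q ^ s * (q - 1) := by
      have h1 : 1 + (q - 1) = q := by have := Fintype.card_pos (α := k); omega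
      rw [mul_comm, ← mul_one_add, h1]
    have : (u ^ q - u) ^ q ^ s = u ^ q ^ s * (u ^ (q ^ s * (q - 1)) - 1) := by
      rw [sub_pow_card_pow, mul_sub_one, ← pow_add, ← pow_mul, hq]
    rw [← map_pow, this, map_mul, map_pow, hu, one_pow, one_mul]
    exact h
  have h2 : v (u ^ q - u) < 1 := by
    by_contra! h'
    exact h1.not_ge (one_le_pow₀ h')
  by_contra! h3
  rw [← prod_sub_algebraMap_eq k u, map_prod] at h2
  exact h2.not_ge (Finset.one_le_prod' fun a _ ↦ h3 a)

lemma eq_of_mul_val_pow_eq_one {n : ℕ} (hn : n ≠ 0) {x y : K} (hx : v T * v x ^ n = 1)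
    (hy : v T * v y ^ n = 1) : v x = v y := by
  have hT0 : v T ≠ 0 := fun h ↦ by simp [h] at hx
  exact (pow_left_inj₀ zero_le zero_le hn).1 (mul_left_cancel₀ hT0 (hx.trans hy.symm))

lemma exists_val_sub_smul_lt_of_top (hs : s ≠ 0) (hT : v T < 1) {x y : K}
    (hx : v T * v x ^ q ^ s = 1) (hDx : v T * v (D x) ^ q ^ s ≤ 1)
    (hy : v T * v y ^ q ^ s = 1) (hDy : v T * v (D y) ^ q ^ s ≤ 1) :
    ∃ a : k, v (y - a • x) < v x := by
  have h1 : 1 < v x := one_lt_of_one_lt_mul_pow hT hx.ge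
  have hQ := (one_lt_card_pow (k := k) hs).ne_bot
  have hx0 : x ≠ 0 := by rintro rfl; simp at h1
  have hxy : v y = v x := eq_of_mul_val_pow_eq_one hQ hy hx
  have hu : v (y / x) = 1 := by rw [map_div₀, hxy, div_self (zero_lt_one.trans h1).ne']
  have h2 : v ((y / x) ^ (q ^ s * (q - 1)) - 1) < 1 := by
    have h3 := v.map_sub_lt (val_one_add_lt hs hT hy hDy) (val_one_add_lt hs hT hx hDx)
    have h4 : (1 + (T * y ^ q ^ s) ^ (q - 1)) - (1 + (T * x ^ q ^ s) ^ (q - 1)) =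
        (T * x ^ q ^ s) ^ (q - 1) * ((y / x) ^ (q ^ s * (q - 1)) - 1) := by
      have : T * y ^ q ^ s = T * x ^ q ^ s * (y / x) ^ q ^ s := by
        rw [div_pow]; field_simp
      rw [this, mul_pow, pow_mul (y / x)]
      ring
    rw [h4, map_mul, map_pow, map_mul, map_pow, hx, one_pow, one_mul] at h3
    exact h3
  obtain ⟨a, ha⟩ := exists_val_sub_smul_lt_one hu h2
  refine ⟨a, ?_⟩
  have : y - a • x = (y / x - algebraMap k K a) * x := by
    rw [Algebra.smul_def, sub_mul, div_mul_cancel₀ _ hx0]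
  rw [this, map_mul]
  exact mul_lt_of_lt_one_left (zero_lt_one.trans h1) ha

section Stable

variable {M : Submodule k K} [Finite M]

lemma mul_val_pow_le_one (hs : s ≠ 0) (hT : v T < 1) (hM : ∀ x ∈ M, D x ∈ M) {x : K}
    (hx : x ∈ M) : v T * v x ^ q ^ s ≤ 1 := by
  obtain ⟨⟨y, hy⟩, hmax⟩ := Finite.exists_max fun z : M ↦ v (z : K)
  have h1 : v T * v y ^ q ^ s ≤ 1 := by
    by_contra! h
    exact (lt_val_drinfeldOp hs hT h).not_ge (hmax ⟨_, hM y hy⟩)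
  exact (mul_le_mul_right (pow_le_pow_left₀ zero_le (hmax ⟨x, hx⟩) _) _).trans h1

lemma exists_mul_val_pow_eq_one (hs : s ≠ 0) (hT : v T < 1) (hM : ∀ x ∈ M, D x ∈ M) {x : K}
    (hx : x ∈ M) (h1 : 1 < v x) : ∃ n : ℕ, v T * v x ^ q ^ (s * (n + 1)) = 1 := by
  by_contra hne
  obtain ⟨⟨y, hy, hy1, hyn⟩, hmax⟩ := @Finite.exists_max
    {z : K // z ∈ M ∧ 1 < v z ∧ ¬ ∃ n : ℕ, v T * v z ^ q ^ (s * (n + 1)) = 1} _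
    (finite_mem_and M _) ⟨⟨x, hx, h1, hne⟩⟩ _ fun z ↦ v z.1
  rcases (mul_val_pow_le_one hs hT hM hy).lt_or_eq with h | h
  · have hD := val_drinfeldOp_of_lt hs hT hy1 h
    have hlt : v y < v (D y) := by
      rw [hD]; exact lt_self_pow₀ hy1 (one_lt_card_pow hs)
    refine (hmax ⟨D y, hM y hy, hy1.trans hlt, ?_⟩).not_gt hlt
    rintro ⟨n, hn⟩
    refine hyn ⟨n + 1, ?_⟩
    rw [hD, ← pow_mul, ← pow_add] at hn
    rw [← hn]
    ring_nf
  · exact hyn ⟨0, by simpa using h⟩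

omit [Algebra k K] in
lemma mul_val_pow_lt_one (hs : s ≠ 0) (hT : v T < 1) {n : ℕ} {x : K}
    (hx : v T * v x ^ q ^ (s * (n + 2)) = 1) : v T * v x ^ q ^ s < 1 := by
  have h1 : 1 < v x := one_lt_of_one_lt_mul_pow hT hx.ge
  have hT0 : 0 < v T := zero_lt_iff.2 fun h ↦ by simp [h] at hx
  rw [← hx]
  refine mul_lt_mul_of_pos_left (pow_lt_pow_right₀ h1 ?_) hT0
  exact Nat.pow_lt_pow_right Fintype.one_lt_card (by nlinarith [Nat.pos_of_ne_zero hs])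

lemma mul_val_drinfeldOp_pow_eq_one (hs : s ≠ 0) (hT : v T < 1) {n : ℕ} {x : K}
    (hx : v T * v x ^ q ^ (s * (n + 2)) = 1) : v T * v (D x) ^ q ^ (s * (n + 1)) = 1 := by
  have h1 : 1 < v x := one_lt_of_one_lt_mul_pow hT hx.ge
  rw [val_drinfeldOp_of_lt hs hT h1 (mul_val_pow_lt_one hs hT hx), ← pow_mul, ← pow_add, ← hx]
  ring_nf

lemma exists_val_sub_smul_lt (hs : s ≠ 0) (hT : v T < 1) (hM : ∀ x ∈ M, D x ∈ M) {n : ℕ}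
    {x y : K} (hx : x ∈ M) (hy : y ∈ M) (hxn : v T * v x ^ q ^ (s * (n + 1)) = 1)
    (hyn : v T * v y ^ q ^ (s * (n + 1)) = 1) : ∃ a : k, v (y - a • x) < v x := by
  induction n generalizing x y with
  | zero =>
    simp only [zero_add, mul_one] at hxn hyn
    exact exists_val_sub_smul_lt_of_top hs hT hxn (mul_val_pow_le_one hs hT hM (hM x hx)) hyn
      (mul_val_pow_le_one hs hT hM (hM y hy))
  | succ n ih =>
    have h1 : 1 < v x := one_lt_of_one_lt_mul_pow hT hxn.ge
    obtain ⟨a, ha⟩ := ih (hM x hx) (hM y hy) (mul_val_drinfeldOp_pow_eq_one hs hT hxn)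
      (mul_val_drinfeldOp_pow_eq_one hs hT hyn)
    refine ⟨a, ?_⟩
    by_contra! h
    have hle : v (y - a • x) ≤ v x := by
      refine v.map_sub_le ?_ (v.map_smul_le a x)
      exact (eq_of_mul_val_pow_eq_one (by simp) hyn hxn).le
    have heq := le_antisymm hle h
    rw [← map_smul, ← map_sub, val_drinfeldOp_of_lt hs hT (by rwa [heq])
      (by rw [heq]; exact mul_val_pow_lt_one hs hT hxn), heq,
      val_drinfeldOp_of_lt hs hT h1 (mul_val_pow_lt_one hs hT hxn)] at ha
    exact ha.false

lemma mul_val_drinfeldOp_iterate_pow_eq_one (hs : s ≠ 0) (hT : v T < 1) {m n : ℕ} {x : K}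
    (hx : v T * v x ^ q ^ (s * (n + m + 1)) = 1) :
    v T * v ((D ^ m) x) ^ q ^ (s * (n + 1)) = 1 := by
  induction m generalizing x with
  | zero => simpa using hx
  | succ m ih =>
    rw [pow_succ, Module.End.mul_apply]
    exact ih (mul_val_drinfeldOp_pow_eq_one hs hT hx)

omit [Finite M] in
lemma pow_mem_of_stable (hM : ∀ x ∈ M, D x ∈ M) {x : K} (hx : x ∈ M) (m : ℕ) :
    (D ^ m) x ∈ M := by
  induction m with
  | zero => simpa
  | succ m ih => rw [pow_succ', Module.End.mul_apply]; exact hM _ ih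

/-- If not all of `M` is integral, a nonintegral element `x` of least absolute value generates
`M` modulo integral elements. -/
lemma exists_generator (hs : s ≠ 0) (hT : v T < 1) (hM : ∀ x ∈ M, D x ∈ M)
    (hne : ∃ x ∈ M, 1 < v x) :
    ∃ x ∈ M, ∃ n : ℕ, v T * v x ^ q ^ (s * (n + 1)) = 1 ∧
      (∀ y ∈ M, v y < v x → v y ≤ 1) ∧
      ∀ y ∈ M, ∃ b ∈ degreeLT k (n + 1), y - aeval D b x ∈ M ∧ v (y - aeval D b x) ≤ 1 := by
  obtain ⟨x', hx', hx1'⟩ := hne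
  obtain ⟨⟨x, hx, hx1⟩, hmin⟩ := @Finite.exists_min {z : K // z ∈ M ∧ 1 < v z} _
    (finite_mem_and M _) ⟨⟨x', hx', hx1'⟩⟩ _ fun z ↦ v z.1
  obtain ⟨n, hn⟩ := exists_mul_val_pow_eq_one hs hT hM hx hx1
  have hT0 : 0 < v T := zero_lt_iff.2 fun h ↦ by simp [h] at hn
  refine ⟨x, hx, n, hn, fun y hy hyx ↦ ?_, ?_⟩
  · by_contra! h
    exact (hmin ⟨y, hy, h⟩).not_gt hyx
  by_contra! hne
  obtain ⟨y', hy', hyb'⟩ := hne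
  obtain ⟨⟨y, hy, hyb⟩, hmin'⟩ := @Finite.exists_min
    {y : K // y ∈ M ∧ ∀ b ∈ degreeLT k (n + 1), y - aeval D b x ∈ M →
      1 < v (y - aeval D b x)} _
    (finite_mem_and M _) ⟨⟨y', hy', hyb'⟩⟩ _ fun z ↦ v z.1
  have hy1 : 1 < v y := by simpa using hyb 0 (zero_mem _) (by simpa using hy)
  obtain ⟨j, hj⟩ := exists_mul_val_pow_eq_one hs hT hM hy hy1
  have hjn : j ≤ n := by
    by_contra! h
    have h1 : v x ^ q ^ (s * (n + 1)) < v y ^ q ^ (s * (j + 1)) :=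
      (pow_lt_pow_right₀ hx1 (Nat.pow_lt_pow_right Fintype.one_lt_card
        (Nat.mul_lt_mul_of_pos_left (by omega) (Nat.pos_of_ne_zero hs)))).trans_le
        (pow_le_pow_left₀ zero_le (hmin ⟨y, hy, hy1⟩) _)
    have h2 := mul_lt_mul_of_pos_left h1 hT0
    rw [hn, hj] at h2
    exact h2.false
  obtain ⟨m, rfl⟩ := Nat.exists_eq_add_of_le hjn
  have hz := mul_val_drinfeldOp_iterate_pow_eq_one hs hT hn
  have hzM := pow_mem_of_stable hM hx m
  obtain ⟨a, ha⟩ := exists_val_sub_smul_lt hs hT hM hzM hy hz hj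
  rw [eq_of_mul_val_pow_eq_one (by simp) hz hj] at ha
  refine (hmin' ⟨y - a • (D ^ m) x, M.sub_mem hy (M.smul_mem a hzM), fun b hb h ↦ ?_⟩).not_gt ha
  have hb' : a • X ^ m + b ∈ degreeLT k (j + m + 1) := by
    refine Submodule.add_mem _ (Submodule.smul_mem _ _ ?_) hb
    rw [mem_degreeLT, degree_X_pow]
    exact_mod_cast (by omega : m < j + m + 1)
  have heq : y - a • (D ^ m) x - aeval D b x = y - aeval D (a • X ^ m + b) x := by
    simp [sub_sub]
  rw [heq] at h ⊢
  exact hyb _ hb' h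

end Stable

variable (v) in
/-- The constants as a subring of the valuation ring. -/
def constantsToValuationSubring : k →+* v.valuationSubring :=
  (algebraMap k K).codRestrict v.valuationSubring.toSubring fun a ↦ by
    rw [ValuationSubring.mem_toSubring, Valuation.mem_valuationSubring_iff,
      Algebra.algebraMap_eq_smul_one]
    simpa using v.map_smul_le a (1 : K)

lemma card_integral_opTorsion_le (hs : s ≠ 0) (hT : v T < 1) {l : k[X]} (hl : l.Monic)
    (hlT : v (aeval T l) = 1) :
    Nat.card {x : K // x ∈ opTorsion k T s l ∧ v x ≤ 1} ≤ q ^ (s * l.natDegree) := by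
  classical
  let κ := IsLocalRing.ResidueField v.valuationSubring
  let ι : k →+* κ := (IsLocalRing.residue _).comp (constantsToValuationSubring v)
  have hres (x : v.valuationSubring) : IsLocalRing.residue _ x = 0 ↔ v (x : K) < 1 := by
    rw [IsLocalRing.residue_eq_zero_iff]
    exact Valuation.mem_maximalIdeal_iff K v
  let g : κ[X] := ∑ i ∈ Finset.range (l.natDegree + 1), C (ι (l.coeff i)) * X ^ q ^ (s * i)
  have hinj : Function.Injective fun i : ℕ ↦ q ^ (s * i) := fun i j hij ↦
    Nat.eq_of_mul_eq_mul_left (Nat.pos_of_ne_zero hs)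
      (Nat.pow_right_injective Fintype.one_lt_card hij)
  have hdeg : g.natDegree ≤ q ^ (s * l.natDegree) := by
    refine natDegree_sum_le_of_forall_le _ _ fun i hi ↦ (natDegree_C_mul_X_pow_le _ _).trans ?_
    exact Nat.pow_le_pow_right Fintype.card_pos
      (Nat.mul_le_mul_left _ (Nat.lt_succ_iff.1 (Finset.mem_range.1 hi)))
  have hg : g ≠ 0 := by
    intro h
    have h1 : g.coeff (q ^ (s * l.natDegree)) = 1 := by
      simp only [g, finsetSum_coeff, coeff_C_mul, coeff_X_pow]
      rw [Finset.sum_eq_single l.natDegree]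
      · simp [hl.coeff_natDegree]
      · intro i _ hi
        rw [if_neg fun h ↦ hi (hinj h.symm), mul_zero]
      · simp
    simp [h] at h1
  let f (x : {x : K // x ∈ opTorsion k T s l ∧ v x ≤ 1}) : {y // y ∈ g.roots.toFinset} :=
    ⟨IsLocalRing.residue _ (⟨x.1, x.2.2⟩ : v.valuationSubring), by
      rw [Multiset.mem_toFinset, mem_roots hg, IsRoot.def]
      have h1 : eval (IsLocalRing.residue _ (⟨x.1, x.2.2⟩ : v.valuationSubring)) g =
          IsLocalRing.residue _ (∑ i ∈ Finset.range (l.natDegree + 1),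
            constantsToValuationSubring v (l.coeff i) *
              (⟨x.1, x.2.2⟩ : v.valuationSubring) ^ q ^ (s * i)) := by
        simp [g, eval_finsetSum, ι]
      rw [h1, hres]
      have h2 : ((∑ i ∈ Finset.range (l.natDegree + 1),
            constantsToValuationSubring v (l.coeff i) *
              (⟨x.1, x.2.2⟩ : v.valuationSubring) ^ q ^ (s * i) : v.valuationSubring) : K) =
          -∑ i ∈ Finset.range (l.natDegree + 1),
            l.coeff i • ((D ^ i) x.1 - x.1 ^ q ^ (s * i)) := by
        have h3 := x.2.1
        rw [mem_opTorsion, aeval_drinfeldOp_eq_sum] at h3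
        simp_rw [smul_sub, Finset.sum_sub_distrib, h3, zero_sub, neg_neg, Algebra.smul_def]
        push_cast
        rfl
      rw [h2, Valuation.map_neg]
      exact v.map_sum_lt' zero_lt_one fun i _ ↦ (v.map_smul_le _ _).trans_lt
        (val_drinfeldOp_pow_sub_pow_lt hs hT x.2.2 i)⟩
  have hf : Function.Injective f := by
    intro x y hxy
    have h1 := (congrArg Subtype.val hxy : IsLocalRing.residue _ _ = IsLocalRing.residue _ _)
    rw [← sub_eq_zero, ← map_sub, hres] at h1
    exact Subtype.ext (sub_eq_zero.1 (eq_zero_of_mem_opTorsion hs hT hlT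
      (Submodule.sub_mem _ x.2.1 y.2.1) h1))
  calc _ ≤ Nat.card {y // y ∈ g.roots.toFinset} := Nat.card_le_card_of_injective f hf
    _ = g.roots.toFinset.card := Nat.card_eq_fintype_card.trans (Fintype.card_coe _)
    _ ≤ g.roots.card := Multiset.toFinset_card_le _
    _ ≤ _ := (card_roots' g).trans hdeg

lemma card_degreeLT (n : ℕ) : Nat.card (degreeLT k n) = q ^ n := by
  rw [Nat.card_congr (degreeLTEquiv k n).toEquiv]
  simp

lemma natDegree_le_of_generator (hs : s ≠ 0) (hT : v T < 1) {l : k[X]} (hl : l.Monic)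
    (hlT : v (aeval T l) = 1) [Finite (opTorsion k T s l)]
    (hcard : q ^ ((s + 1) * l.natDegree) ≤ Nat.card (opTorsion k T s l)) {x : K} {n : ℕ}
    (hx : ∀ y ∈ opTorsion k T s l, ∃ b ∈ degreeLT k n,
      y - aeval D b x ∈ opTorsion k T s l ∧ v (y - aeval D b x) ≤ 1) :
    l.natDegree ≤ n := by
  choose b hb hbM hbv using hx
  let f (y : opTorsion k T s l) :
      degreeLT k n × {x : K // x ∈ opTorsion k T s l ∧ v x ≤ 1} :=
    (⟨b y y.2, hb y y.2⟩, ⟨y - aeval D (b y y.2) x, hbM y y.2, hbv y y.2⟩)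
  have hf : Function.Injective f := by
    intro y z hyz
    simp only [f, Prod.mk.injEq, Subtype.mk.injEq] at hyz
    obtain ⟨h1, h2⟩ := hyz
    rw [h1] at h2
    exact Subtype.ext (sub_left_injective h2)
  have : Finite (degreeLT k n) := Finite.of_equiv _ (degreeLTEquiv k n).toEquiv.symm
  have : Finite {x : K // x ∈ opTorsion k T s l ∧ v x ≤ 1} :=
    finite_mem_and _ _
  have h := hcard.trans (Nat.card_le_card_of_injective f hf)
  rw [Nat.card_prod, card_degreeLT] at h
  have h2 := h.trans (Nat.mul_le_mul_left _ (card_integral_opTorsion_le hs hT hl hlT))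
  rw [← pow_add, Nat.pow_le_pow_iff_right Fintype.one_lt_card] at h2
  linarith

end Valuation

section Galois

variable {k : Type*} [Field k] [Fintype k] {F K : Type*} [Field F] [Field K] [Algebra k F]
  [Algebra k K] [Algebra F K] [IsScalarTower k F K]
  {Γ : Type*} [LinearOrderedCommGroupWithZero Γ] {v : Valuation K Γ} {t : F} {s : ℕ}

local notation "T" => algebraMap F K t
local notation "D" => drinfeldOp k T s
local notation "q" => Fintype.card k

omit [Algebra k F] [IsScalarTower k F K] in
lemma map_drinfeldOp (σ : K ≃ₐ[F] K) (x : K) : σ (D x) = D (σ x) := by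
  simp [drinfeldOp_apply]

lemma map_aeval_drinfeldOp (σ : K ≃ₐ[F] K) (b : k[X]) (x : K) :
    σ (aeval D b x) = aeval D b (σ x) := by
  have hpow (i : ℕ) : σ ((D ^ i) x) = (D ^ i) (σ x) := by
    induction i with
    | zero => simp
    | succ i ih => rw [pow_succ', Module.End.mul_apply, map_drinfeldOp, ih, Module.End.mul_apply]
  rw [aeval_drinfeldOp_eq_sum, aeval_drinfeldOp_eq_sum, map_sum]
  refine Finset.sum_congr rfl fun i _ ↦ ?_
  rw [← hpow]
  exact (σ.toLinearMap.restrictScalars k).map_smul _ _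

lemma map_mem_opTorsion (σ : K ≃ₐ[F] K) {l : k[X]} {x : K} (hx : x ∈ opTorsion k T s l) :
    σ x ∈ opTorsion k T s l := by
  rw [mem_opTorsion] at hx ⊢
  rw [← map_aeval_drinfeldOp, hx, map_zero]

lemma map_eq_self_of_val_le_one (hs : s ≠ 0) (hT : v T < 1) {l : k[X]}
    (hlT : v (aeval T l) = 1) {σ : K ≃ₐ[F] K} (hσ : ∀ y, v y ≤ 1 → v (σ y - y) < 1) {x : K}
    (hx : x ∈ opTorsion k T s l) (h1 : v x ≤ 1) : σ x = x :=
  sub_eq_zero.1 (eq_zero_of_mem_opTorsion hs hT hlT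
    (Submodule.sub_mem _ (map_mem_opTorsion σ hx) hx) (hσ x h1))

/-- The inertia group acts on the torsion through unipotent matrices, hence has at most
`q ^ (s * deg l)` elements; and some torsion point has valuation `- v(T) / q ^ (s * n)` with
`deg l ≤ n`. -/
theorem card_inertia_le_and_exists (hs : s ≠ 0) (hT : v T < 1) {l : k[X]} (hl : l.Monic)
    (hl0 : l.natDegree ≠ 0) (hlT : v (aeval T l) = 1) [Finite (opTorsion k T s l)]
    (hcard : q ^ ((s + 1) * l.natDegree) ≤ Nat.card (opTorsion k T s l))
    (hgen : IntermediateField.adjoin F (opTorsion k T s l : Set K) = ⊤) :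
    Nat.card {σ : K ≃ₐ[F] K // ∀ y, v y ≤ 1 → v (σ y - y) < 1} ≤ q ^ (s * l.natDegree) ∧
    ∃ (x : K) (n : ℕ), l.natDegree ≤ n ∧ v T * v x ^ q ^ (s * n) = 1 := by
  have hW := card_integral_opTorsion_le hs hT hl hlT
  have hfin : Finite {x : K // x ∈ opTorsion k T s l ∧ v x ≤ 1} :=
    finite_mem_and _ _
  have hne : ∃ x ∈ opTorsion k T s l, 1 < v x := by
    by_contra! h
    have h1 : Nat.card (opTorsion k T s l) ≤
        Nat.card {x : K // x ∈ opTorsion k T s l ∧ v x ≤ 1} :=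
      Nat.card_le_card_of_injective (fun z ↦ ⟨z.1, z.2, h _ z.2⟩) fun a b hab ↦
        Subtype.ext (by simpa only [Subtype.mk.injEq] using hab)
    have h2 := hcard.trans (h1.trans hW)
    rw [Nat.pow_le_pow_iff_right Fintype.one_lt_card] at h2
    have := Nat.pos_of_ne_zero hl0
    linarith
  obtain ⟨x, hx, n, hn, hmin, hspan⟩ :=
    exists_generator hs hT (fun _ ↦ drinfeldOp_mem_opTorsion) hne
  refine ⟨?_, x, n + 1, natDegree_le_of_generator hs hT hl hlT hcard hspan, hn⟩
  have hT0 : 0 < v T := zero_lt_iff.2 fun h ↦ by simp [h] at hn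
  have hσint (σ : {σ : K ≃ₐ[F] K // ∀ y, v y ≤ 1 → v (σ y - y) < 1}) : v (σ.1 x - x) ≤ 1 := by
    refine hmin _ (Submodule.sub_mem _ (map_mem_opTorsion σ.1 hx) hx) ?_
    have h1 := σ.2 (T * x ^ q ^ (s * (n + 1))) (by rw [map_mul, map_pow, hn])
    rw [map_mul, AlgEquiv.commutes, map_pow, ← mul_sub, ← sub_pow_card_pow, map_mul,
      map_pow] at h1
    exact lt_of_pow_lt_pow_left₀ _ zero_le ((mul_lt_mul_iff_right₀ hT0).1 (h1.trans_eq hn.symm))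
  refine (Nat.card_le_card_of_injective (fun σ ↦ ⟨σ.1 x - x,
    Submodule.sub_mem _ (map_mem_opTorsion σ.1 hx) hx, hσint σ⟩) ?_).trans hW
  · intro σ τ hστ
    have hστ' : σ.1 x = τ.1 x := by simpa using hστ
    refine Subtype.ext (AlgEquiv.ext fun z ↦ ?_)
    have hz : z ∈ IntermediateField.adjoin F (opTorsion k T s l : Set K) :=
      hgen ▸ IntermediateField.mem_top
    induction hz using IntermediateField.adjoin_induction with
    | algebraMap a => simp
    | add a b _ _ ha hb => rw [map_add, map_add, ha, hb]
    | inv a _ ha => rw [map_inv₀, map_inv₀, ha]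
    | mul a b _ _ ha hb => rw [map_mul, map_mul, ha, hb]
    | mem y hy =>
      obtain ⟨b, -, hbM, hb1⟩ := hspan y hy
      have key (ρ : {σ : K ≃ₐ[F] K // ∀ y, v y ≤ 1 → v (σ y - y) < 1}) :
          ρ.1 y = y - aeval D b x + aeval D b (ρ.1 x) := by
        rw [← map_aeval_drinfeldOp, ← map_eq_self_of_val_le_one hs hT hlT ρ.2 hbM hb1, ← map_add,
          sub_add_cancel]
      rw [key σ, key τ, hστ']

end Galois

section TorsionPolynomial

variable (k : Type*) [Field k] [Fintype k] {F : Type*} [Field F] [Algebra k F]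

/-- The polynomial inducing the `i`-th power of `drinfeldOp k t s`. -/
def opPowPoly (t : F) (s : ℕ) : ℕ → F[X]
  | 0 => X
  | i + 1 => C t * opPowPoly t s i + opPowPoly t s i ^ Fintype.card k ^ s +
      C (t ^ (Fintype.card k - 1)) * opPowPoly t s i ^ Fintype.card k ^ (s + 1)

variable {k}

/-- The polynomial inducing the action of `l` through `drinfeldOp k t s`. -/
def torsionPoly (t : F) (s : ℕ) (l : k[X]) : F[X] :=
  ∑ i ∈ Finset.range (l.natDegree + 1), C (algebraMap k F (l.coeff i)) * opPowPoly k t s i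

variable {K : Type*} [Field K] [Algebra k K] [Algebra F K] [IsScalarTower k F K] {t : F} {s : ℕ}

local notation "q" => Fintype.card k

omit [Algebra k F] [IsScalarTower k F K] in
lemma aeval_opPowPoly (x : K) (i : ℕ) :
    aeval x (opPowPoly k t s i) = (drinfeldOp k (algebraMap F K t) s ^ i) x := by
  induction i with
  | zero => simp [opPowPoly]
  | succ i ih =>
    rw [pow_succ', Module.End.mul_apply, ← ih, drinfeldOp_apply]
    simp [opPowPoly]

lemma aeval_torsionPoly (l : k[X]) (x : K) :
    aeval x (torsionPoly t s l) = aeval (drinfeldOp k (algebraMap F K t) s) l x := by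
  rw [aeval_drinfeldOp_eq_sum, torsionPoly, map_sum]
  refine Finset.sum_congr rfl fun i _ ↦ ?_
  rw [map_mul, aeval_C, aeval_opPowPoly, ← IsScalarTower.algebraMap_apply, Algebra.smul_def]

include k in
lemma derivative_pow_card_pow (hs : s ≠ 0) (f : F[X]) : derivative (f ^ q ^ s) = 0 := by
  have h : ((q ^ s : ℕ) : F) = 0 := by
    rw [← map_natCast (algebraMap k F), Nat.cast_pow, FiniteField.cast_card_eq_zero,
      zero_pow hs, map_zero]
  rw [derivative_pow, h, C_0, zero_mul, zero_mul]

lemma derivative_opPowPoly (hs : s ≠ 0) (i : ℕ) : derivative (opPowPoly k t s i) = C (t ^ i) := by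
  induction i with
  | zero => simp [opPowPoly]
  | succ i ih =>
    rw [opPowPoly, derivative_add, derivative_add, derivative_C_mul, derivative_C_mul,
      derivative_pow_card_pow hs, derivative_pow_card_pow s.succ_ne_zero, ih]
    simp [pow_succ']

lemma derivative_torsionPoly (hs : s ≠ 0) (l : k[X]) :
    derivative (torsionPoly t s l) = C (aeval t l) := by
  simp [torsionPoly, derivative_opPowPoly hs, aeval_eq_sum_range, Algebra.smul_def]

lemma separable_torsionPoly (hs : s ≠ 0) {l : k[X]} (hl : aeval t l ≠ 0) :
    (torsionPoly t s l).Separable := by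
  rw [separable_def, derivative_torsionPoly hs]
  obtain ⟨u, hu⟩ := isUnit_C.2 hl.isUnit
  exact ⟨0, ↑u⁻¹, by rw [zero_mul, zero_add, ← hu, Units.inv_mul]⟩

omit [Algebra k F] in
lemma natDegree_opPowPoly (ht : t ≠ 0) (i : ℕ) :
    (opPowPoly k t s i).natDegree = q ^ ((s + 1) * i) := by
  induction i with
  | zero => simp [opPowPoly]
  | succ i ih =>
    have h0 : 0 < q ^ ((s + 1) * i) := pow_pos Fintype.card_pos _
    have h3 : (C (t ^ (q - 1)) * opPowPoly k t s i ^ q ^ (s + 1)).natDegree =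
        q ^ ((s + 1) * (i + 1)) := by
      rw [natDegree_C_mul (pow_ne_zero _ ht), natDegree_pow, ih, ← pow_add]
      ring
    rw [opPowPoly, natDegree_add_eq_right_of_natDegree_lt, h3]
    rw [h3, mul_add_one, pow_add]
    refine (natDegree_add_le _ _).trans_lt (max_lt ?_ ?_)
    · rw [natDegree_C_mul ht, ih]
      exact lt_mul_of_one_lt_right h0 (one_lt_card_pow s.succ_ne_zero)
    · rw [natDegree_pow, ih, mul_comm]
      exact Nat.mul_lt_mul_of_pos_left
        (Nat.pow_lt_pow_right Fintype.one_lt_card s.lt_succ_self) h0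

lemma natDegree_torsionPoly (ht : t ≠ 0) {l : k[X]} (hl : l.Monic) :
    (torsionPoly t s l).natDegree = q ^ ((s + 1) * l.natDegree) := by
  have h0 : 0 < q ^ ((s + 1) * l.natDegree) := pow_pos Fintype.card_pos _
  rw [torsionPoly, Finset.sum_range_succ, hl.coeff_natDegree, map_one, C_1, one_mul,
    natDegree_add_eq_right_of_natDegree_lt, natDegree_opPowPoly ht]
  rw [natDegree_opPowPoly ht]
  rcases Nat.eq_zero_or_pos l.natDegree with h | h
  · simp [h]
  refine lt_of_le_of_lt (natDegree_sum_le_of_forall_le (n := q ^ ((s + 1) * (l.natDegree - 1)))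
    _ _ fun i hi ↦ (natDegree_C_mul_le _ _).trans ?_) ?_
  · rw [natDegree_opPowPoly ht]
    exact Nat.pow_le_pow_right Fintype.card_pos
      (Nat.mul_le_mul_left _ (Nat.le_sub_one_of_lt (Finset.mem_range.1 hi)))
  · exact Nat.pow_lt_pow_right Fintype.one_lt_card
      (Nat.mul_lt_mul_of_pos_left (Nat.sub_lt h one_pos) s.succ_pos)

lemma rootSet_torsionPoly (ht : t ≠ 0) {l : k[X]} (hl : l.Monic) :
    (torsionPoly t s l).rootSet K = opTorsion k (algebraMap F K t) s l := by
  have h0 : torsionPoly t s l ≠ 0 := ne_zero_of_natDegree_gt (n := 0) <| by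
    rw [natDegree_torsionPoly ht hl]; exact pow_pos Fintype.card_pos _
  ext x
  rw [mem_rootSet_of_ne h0, aeval_torsionPoly, SetLike.mem_coe, mem_opTorsion]

lemma card_opTorsion (hs : s ≠ 0) (ht : t ≠ 0) {l : k[X]} (hl : l.Monic) (hlt : aeval t l ≠ 0)
    (hK : ((torsionPoly t s l).map (algebraMap F K)).Splits) :
    Nat.card (opTorsion k (algebraMap F K t) s l) = q ^ ((s + 1) * l.natDegree) := by
  rw [← natDegree_torsionPoly (s := s) ht hl,
    ← card_rootSet_eq_natDegree (separable_torsionPoly hs hlt) hK, ← Nat.card_eq_fintype_card]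
  exact Nat.card_congr (Equiv.setCongr (rootSet_torsionPoly ht hl).symm)

end TorsionPolynomial

section Ramification

open IsDedekindDomain

variable {A F K : Type*} [CommRing A] [IsDedekindDomain A] [Field F] [Algebra A F]
  [IsFractionRing A F] [Field K] [Algebra A K] [Algebra F K] [IsScalarTower A F K]
  [FiniteDimensional F K]

omit [IsDedekindDomain A] [IsFractionRing A F] [FiniteDimensional F K] in
lemma forall_val_sub_lt_one_iff [IsDedekindDomain (integralClosure A K)]
    [IsFractionRing (integralClosure A K) K] (w : HeightOneSpectrum (integralClosure A K))
    (σ : K ≃ₐ[F] K) :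
    (∀ y, w.valuation K y ≤ 1 → w.valuation K (σ y - y) < 1) ↔
      ∀ x : integralClosure A K, σ • x - x ∈ w.asIdeal := by
  have hσint (x : integralClosure A K) : w.valuation K (σ x - x) < 1 ↔ σ • x - x ∈ w.asIdeal := by
    rw [← w.valuation_lt_one_iff_mem (K := K)]
    rfl
  refine ⟨fun h x ↦ (hσint x).1 (h x (w.valuation_le_one x)), fun h y hy ↦ ?_⟩
  obtain ⟨n, d, hnd⟩ := w.exists_primeCompl_mul_eq_of_integer y hy
  have hd : w.valuation K (d : integralClosure A K) = 1 := w.valuation_eq_one_iff_notMem.2 d.2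
  have hσd : w.valuation K (σ (d : integralClosure A K)) = 1 := by
    have h1 := w.valuation K |>.map_add_eq_of_lt_left
      (((hσint d).2 (h d)).trans_eq hd.symm)
    rwa [add_sub_cancel, hd] at h1
  have hnd' : y * (d : integralClosure A K) = n := hnd
  have key : (σ y - y) * σ (d : integralClosure A K) =
      (σ n - n) - y * (σ (d : integralClosure A K) - (d : integralClosure A K)) := by
    rw [← hnd', map_mul]
    ring
  have h2 : w.valuation K ((σ y - y) * σ (d : integralClosure A K)) < 1 := by
    rw [key]
    refine (w.valuation K).map_sub_lt ((hσint n).2 (h n)) ?_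
    rw [map_mul]
    exact (mul_le_of_le_one_left' hy).trans_lt ((hσint d).2 (h d))
  rwa [map_mul, hσd, mul_one] at h2

lemma valuation_pow_card_inertia [IsGalois F K] [IsDedekindDomain (integralClosure A K)]
    [IsFractionRing (integralClosure A K) K] (p : HeightOneSpectrum A) [Finite (A ⧸ p.asIdeal)]
    (w : HeightOneSpectrum (integralClosure A K)) [w.asIdeal.LiesOver p.asIdeal] (x : F) :
    p.valuation F x ^ Nat.card (w.asIdeal.inertia (K ≃ₐ[F] K)) =
      w.valuation K (algebraMap F K x) := by
  have : FaithfulSMul A K := .trans A F K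
  have : Module.Finite A (integralClosure A K) :=
    IsIntegralClosure.finite A F K (integralClosure A K)
  have : IsGaloisGroup (K ≃ₐ[F] K) A (integralClosure A K) :=
    IsGaloisGroup.of_isFractionRing _ A (integralClosure A K) F K
  rw [Ideal.card_inertia_eq_ramificationIdxIn p.asIdeal w.asIdeal,
    Ideal.ramificationIdxIn_eq_ramificationIdx p.asIdeal w.asIdeal (K ≃ₐ[F] K),
    ← Ideal.ramificationIdx'_eq_ramificationIdx p.asIdeal w.asIdeal p.ne_bot,
    HeightOneSpectrum.valuation_liesOver K p w]

end Ramification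

section FunctionField

open IsDedekindDomain

variable {k : Type} [Field k] [Fintype k] {K : Type} [Field K] [Algebra k K] [Algebra k[X] K]
  [Algebra (RatFunc k) K] [IsScalarTower k (RatFunc k) K] [IsScalarTower k[X] (RatFunc k) K]
  {s : ℕ}

local notation "q" => Fintype.card k

lemma le_of_exp_mul_pow_eq_one {e N : ℕ} (he : e ≠ 0) {y : WithZero (Multiplicative ℤ)}
    (h : WithZero.exp (-1 : ℤ) ^ e * y ^ N = 1) : N ≤ e := by
  rcases Nat.eq_zero_or_pos N with rfl | hN
  · exact Nat.zero_le _
  have hy : y ≠ 0 := by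
    rintro rfl
    rw [zero_pow hN.ne', mul_zero] at h
    exact zero_ne_one h
  rw [← WithZero.exp_log hy, ← WithZero.exp_nsmul, ← WithZero.exp_nsmul, ← WithZero.exp_add,
    ← WithZero.exp_zero, WithZero.exp_inj, nsmul_eq_mul, nsmul_eq_mul] at h
  exact Nat.le_of_dvd (Nat.pos_of_ne_zero he) (Int.natCast_dvd_natCast.1 ⟨y.log, by linarith⟩)

theorem card_inertia_torsionPoly (hs : s ≠ 0) {l : k[X]} (hlm : l.Monic) (hl : Irreducible l)
    (hlX : l ≠ X) [(torsionPoly (RatFunc.X : RatFunc k) s l).IsSplittingField (RatFunc k) K]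
    (P : Ideal (integralClosure k[X] K)) [P.IsPrime]
    (hPT : P.comap (algebraMap k[X] (integralClosure k[X] K)) = Ideal.span {X}) :
    Nat.card {σ : K ≃ₐ[RatFunc k] K // ∀ x : integralClosure k[X] K, σ • x - x ∈ P} =
      q ^ (s * l.natDegree) := by
  have hlt : aeval (RatFunc.X : RatFunc k) l ≠ 0 := by
    rw [← RatFunc.algebraMap_X, aeval_algebraMap_apply, aeval_X_left_apply]
    simpa using hl.ne_zero
  have hsep := separable_torsionPoly hs hlt
  have : FiniteDimensional (RatFunc k) K :=
    IsSplittingField.finiteDimensional K (torsionPoly (RatFunc.X : RatFunc k) s l)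
  have : IsGalois (RatFunc k) K := .of_separable_splitting_field hsep
  have : IsDedekindDomain (integralClosure k[X] K) :=
    integralClosure.isDedekindDomain k[X] (RatFunc k) K
  have : IsFractionRing (integralClosure k[X] K) K :=
    integralClosure.isFractionRing_of_finite_extension (RatFunc k) K
  have : FaithfulSMul k[X] K := .trans k[X] (RatFunc k) K
  have hXP : algebraMap k[X] (integralClosure k[X] K) X ∈ P := by
    rw [← Ideal.mem_comap, hPT]
    exact Ideal.mem_span_singleton_self X
  have hlP : algebraMap k[X] (integralClosure k[X] K) l ∉ P := by
    rw [← Ideal.mem_comap, hPT, Ideal.mem_span_singleton]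
    exact fun h ↦ hlX (eq_of_monic_of_associated hlm monic_X
      (((irreducible_X).dvd_irreducible_iff_associated hl).1 h).symm)
  let p : HeightOneSpectrum k[X] := ⟨Ideal.span {X},
    (Ideal.span_singleton_prime X_ne_zero).2 prime_X, by simp⟩
  let w : HeightOneSpectrum (integralClosure k[X] K) := ⟨P, ‹_›, by
    rintro rfl
    rw [Ideal.mem_bot] at hXP
    exact X_ne_zero ((FaithfulSMul.algebraMap_injective _ _) (hXP.trans (map_zero _).symm))⟩
  have : w.asIdeal.LiesOver p.asIdeal := ⟨hPT.symm⟩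
  have : Finite (k[X] ⧸ p.asIdeal) := by
    have : Module.Finite k (k[X] ⧸ Ideal.span {(X : k[X])}) := monic_X.finite_quotient
    exact Module.finite_of_finite k
  have hval (b : k[X]) : w.valuation K (algebraMap (RatFunc k) K (algebraMap k[X] (RatFunc k) b)) =
      w.valuation K (algebraMap (integralClosure k[X] K) K (algebraMap k[X] _ b)) := by
    rw [← IsScalarTower.algebraMap_apply, ← IsScalarTower.algebraMap_apply]
  have hT : w.valuation K (algebraMap (RatFunc k) K RatFunc.X) < 1 := by
    rw [← RatFunc.algebraMap_X, hval]
    exact (w.valuation_lt_one_iff_mem _).2 hXP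
  have hlT : w.valuation K (aeval (algebraMap (RatFunc k) K RatFunc.X) l) = 1 := by
    rw [aeval_algebraMap_apply, ← RatFunc.algebraMap_X, aeval_algebraMap_apply,
      aeval_X_left_apply, hval]
    exact w.valuation_eq_one_iff_notMem.2 hlP
  have hcard := card_opTorsion hs RatFunc.X_ne_zero hlm hlt
    (IsSplittingField.splits K (torsionPoly (RatFunc.X : RatFunc k) s l))
  have hroot := rootSet_torsionPoly (K := K) (s := s) (RatFunc.X_ne_zero (K := k)) hlm
  have : Finite (opTorsion k (algebraMap (RatFunc k) K RatFunc.X) s l) :=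
    Nat.finite_of_card_ne_zero (hcard.trans_ne (pow_pos Fintype.card_pos _).ne')
  have hgen : IntermediateField.adjoin (RatFunc k)
      (opTorsion k (algebraMap (RatFunc k) K RatFunc.X) s l : Set K) = ⊤ := by
    rw [← hroot]
    exact IntermediateField.adjoin_eq_top_of_algebra _ _
      (IsSplittingField.adjoin_rootSet K (torsionPoly (RatFunc.X : RatFunc k) s l))
  obtain ⟨hle, x, n, hn, hx⟩ := card_inertia_le_and_exists (v := w.valuation K) hs hT hlm
    hl.natDegree_pos.ne' hlT hcard.ge hgen
  simp_rw [forall_val_sub_lt_one_iff] at hle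
  refine hle.antisymm ?_
  have hpX : p.valuation (RatFunc k) RatFunc.X = WithZero.exp (-1 : ℤ) := by
    rw [← RatFunc.algebraMap_X, p.valuation_of_algebraMap]
    exact p.intValuation_singleton X_ne_zero rfl
  rw [← valuation_pow_card_inertia p w, hpX] at hx
  exact (Nat.pow_le_pow_right Fintype.card_pos (Nat.mul_le_mul_left s hn)).trans
    (le_of_exp_mul_pow_eq_one
      (Nat.card_pos (α := w.asIdeal.inertia (K ≃ₐ[RatFunc k] K))).ne' hx)

end FunctionField

lemma phi_eq_aeval_drinfeldOp (Fq : Type) [Field Fq] [Fintype Fq] {r : ℕ} (hr : r ≠ 0)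
    {φ : Polynomial Fq →+* AddMonoid.End (Kbar Fq)}
    (hφ : IsDrinfeldPhi Fq (Fintype.card Fq) r φ) (b : Fq[X]) (x : Kbar Fq) :
    φ b x = aeval (drinfeldOp Fq (algebraMap (RatFunc Fq) (Kbar Fq) RatFunc.X) (r - 1)) b x := by
  have hr1 : r - 1 + 1 = r := Nat.sub_one_add_one hr
  have hC (c : Fq) (x : Kbar Fq) : φ (C c) x = c • x := by
    rw [hφ.1, Algebra.smul_def, IsScalarTower.algebraMap_apply Fq (RatFunc Fq) (Kbar Fq)]
    rfl
  have hX (x : Kbar Fq) :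
      φ X x = drinfeldOp Fq (algebraMap (RatFunc Fq) (Kbar Fq) RatFunc.X) (r - 1) x := by
    rw [hφ.2, drinfeldOp_apply, hr1]
  induction b using Polynomial.induction_on' generalizing x with
  | add a b ha hb =>
    rw [map_add, map_add]
    exact congrArg₂ (· + ·) (ha x) (hb x)
  | monomial n a =>
    rw [← C_mul_X_pow_eq_monomial, map_mul, AddMonoid.End.coe_mul, Function.comp_apply, hC,
      map_mul, aeval_C, Module.End.mul_apply, Module.algebraMap_end_apply, map_pow, map_pow,
      aeval_X]
    congr 1
    induction n generalizing x with
    | zero => simp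
    | succ n ih =>
      rw [pow_succ, pow_succ, AddMonoid.End.coe_mul, Function.comp_apply, Module.End.mul_apply,
        hX, ih]

/-- Assume `p > r!`. For `𝔩 = (l) ≠ (T)` and `P` a prime of the integral closure `B` of
`A` in `K = F(φ[𝔩])` lying over `(T)`, the inertia group `I(P)` has order exactly
`|𝔽_𝔩|^{r−1} = q^{(r−1)·deg l}` (the ramification index of `P` over `(T)`). -/
theorem inertia_at_T_card
    (p e q r : ℕ) (hp : p.Prime) (hp5 : 5 ≤ p) (he : 0 < e) (hq : q = p ^ e)
    (hr : r.Prime) (hr3 : 3 ≤ r) (hfac : r.factorial < p)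
    (Fq : Type) [Field Fq] [Fintype Fq] (hFq : Fintype.card Fq = q)
    (φ : Polynomial Fq →+* AddMonoid.End (Kbar Fq)) (hφ : IsDrinfeldPhi Fq q r φ)
    (l : Polynomial Fq) (hlm : l.Monic) (hl : Irreducible l) (hlX : l ≠ X)
    (P : Ideal ↥(integralClosure (Polynomial Fq) ↥(torsionField Fq φ l)))
    (hP : P.IsPrime)
    (hPT : P.comap (algebraMap (Polynomial Fq)
        ↥(integralClosure (Polynomial Fq) ↥(torsionField Fq φ l))) =
      Ideal.span {(X : Polynomial Fq)}) :
    Nat.card {σ : ↥(torsionField Fq φ l) ≃ₐ[RatFunc Fq] ↥(torsionField Fq φ l) //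
        InInertia Fq φ l P σ} = q ^ ((r - 1) * l.natDegree) := by
  subst hFq
  have hs : r - 1 ≠ 0 := by omega
  have htor : phiTorsion Fq φ l =
      (torsionPoly (RatFunc.X : RatFunc Fq) (r - 1) l).rootSet (Kbar Fq) := by
    rw [rootSet_torsionPoly RatFunc.X_ne_zero hlm]
    ext x
    rw [phiTorsion, Set.mem_ofPred_eq, phi_eq_aeval_drinfeldOp Fq hr.ne_zero hφ]
    rfl
  have : (torsionPoly (RatFunc.X : RatFunc Fq) (r - 1) l).IsSplittingField (RatFunc Fq)
      (torsionField Fq φ l) := by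
    rw [torsionField, htor]
    exact IntermediateField.adjoin_rootSet_isSplittingField (IsAlgClosed.splits _)
  rw [← card_inertia_torsionPoly hs hlm hl hlX P hPT]
  refine Nat.card_congr (Equiv.subtypeEquivRight fun σ ↦ forall_congr' fun x ↦ ?_)
  refine ⟨?_, fun h ↦ ⟨_, h, rfl⟩⟩
  rintro ⟨y, hy, hyx⟩
  rwa [show σ • x - x = y from Subtype.ext hyx.symm]
end
end

section
/- Assume in addition p > r!. Let 𝔩 ≠ (T) be a nonzero prime ideal of A with monic generator l, and let E ⊆ F̄ be the compositum of F with the algebraic closure of 𝔽_q inside F̄ (so E is isomorphic to the rational function field 𝔽̄_q(T)). Then φ[𝔩] ∩ E = {0}: for every nonzero element w ∈ E one has φ_l(w) ≠ 0. In particular, for any nonzero Galois-stable subspace X ⊆ φ[𝔩], the extension 𝔽̄_q·F(X) over 𝔽̄_q·F is nontrivial. -/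
set_option synthInstance.maxHeartbeats 1000000
set_option maxHeartbeats 1000000

open Polynomial

noncomputable section

/-- `V` is a Galois-stable `𝔽_𝔩`-subspace of `φ[𝔩]` (for `𝔩 = (l)`): a subset of the
`l`-torsion containing `0`, closed under addition and under the `A`-action through `φ`
(hence an `A/𝔩 = 𝔽_𝔩`-subspace), and stable under `Gal(F̄/F)`. -/
def IsGaloisStableSubspace (Fq : Type) [Field Fq]
    (φ : Polynomial Fq →+* AddMonoid.End (Kbar Fq)) (l : Polynomial Fq)
    (V : Set (Kbar Fq)) : Prop :=
  V ⊆ phiTorsion Fq φ l ∧ (0 : Kbar Fq) ∈ V ∧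
  (∀ x ∈ V, ∀ y ∈ V, x + y ∈ V) ∧
  (∀ b : Polynomial Fq, ∀ x ∈ V, φ b x ∈ V) ∧
  (∀ σ : Kbar Fq ≃ₐ[RatFunc Fq] Kbar Fq, ∀ x ∈ V, σ x ∈ V)

/-- `E = 𝔽̄_q·F ⊆ F̄`: the compositum of `F` with the algebraic closure of `𝔽_q`
inside `F̄` (isomorphic to `𝔽̄_q(T)`). -/
def constFieldExt (Fq : Type) [Field Fq] : IntermediateField (RatFunc Fq) (Kbar Fq) :=
  IntermediateField.adjoin (RatFunc Fq) {x : Kbar Fq | IsAlgebraic Fq x}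

open WithZero in
/-- A map `u ↦ T·u + u^a + T^{q-1}·u^{qa}` on rational functions strictly increases the degree. -/
lemma inftyValuation_lt_twisted_poly {k : Type*} [Field k] [DecidableEq (RatFunc k)] {q a : ℕ} (hq : 3 ≤ q) (ha : 2 ≤ a)
    {u : RatFunc k} (hu : u ≠ 0) :
    RatFunc.inftyValuation k u < RatFunc.inftyValuation k
      (RatFunc.X * u + u ^ a + RatFunc.X ^ (q - 1) * u ^ (q * a)) := by
  set v := RatFunc.inftyValuation k
  set d := u.intDegree with hd
  have hvu : v u = exp d := RatFunc.inftyValuation_of_nonzero k hu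
  have hX : v RatFunc.X = exp 1 := RatFunc.inftyValuation.X k
  have h1 : v (RatFunc.X * u) = exp (1 + d) := by rw [map_mul, hX, hvu, exp_add]
  have h2 : v (u ^ a) = exp (a * d) := by
    rw [map_pow, hvu, ← exp_nsmul, nsmul_eq_mul]
  have h3 : v (RatFunc.X ^ (q - 1) * u ^ (q * a)) = exp ((q - 1) + q * a * d) := by
    rw [map_mul, map_pow, map_pow, hX, hvu, ← exp_nsmul, ← exp_nsmul, ← exp_add]
    simp [Nat.cast_sub (show 1 ≤ q by omega)]
  have hq' : (3 : ℤ) ≤ q := by exact_mod_cast hq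
  have ha' : (2 : ℤ) ≤ a := by exact_mod_cast ha
  rcases le_or_gt 0 d with h0 | h0
  · have key : v (RatFunc.X * u + u ^ a) < v (RatFunc.X ^ (q - 1) * u ^ (q * a)) := by
      have had : d ≤ a * d := by nlinarith
      have hqad : a * d ≤ q * a * d := by nlinarith [mul_nonneg (by linarith : (0 : ℤ) ≤ a) h0]
      refine v.map_add_lt ?_ ?_
      · rw [h1, h3, exp_lt_exp]
        linarith
      · rw [h2, h3, exp_lt_exp]
        linarith
    rw [v.map_add_eq_of_lt_right key, h3, hvu, exp_lt_exp]
    nlinarith [mul_nonneg (by linarith : (0 : ℤ) ≤ a) h0,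
      mul_nonneg (mul_nonneg (by linarith : (0 : ℤ) ≤ q) (by linarith : (0 : ℤ) ≤ a)) h0]
  · have had : a * d ≤ 2 * d := by nlinarith
    have hqad : (q - 1) + q * a * d ≤ a * d := by nlinarith
    rw [add_assoc, v.map_add_eq_of_lt_left, h1, hvu, exp_lt_exp]
    · linarith
    · refine v.map_add_lt ?_ ?_
      · rw [h2, h1, exp_lt_exp]
        linarith
      · rw [h3, h1, exp_lt_exp]
        linarith

/-- If `φ_T` acts on the image of a rational function field by `u ↦ T·u + u^a + T^{q-1}·u^{qa}`
and constants act by constants, then `φ_f` for `f ≠ 0` preserves this image and does not decrease the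
degree of a nonzero rational function. -/
lemma exists_apply_eq_inftyValuation_le {Fq k L : Type*} [Field Fq] [Field k] [Field L]
    [DecidableEq (RatFunc k)]
    (φ : Polynomial Fq →+* AddMonoid.End L) (ι : RatFunc k →+* L) (j : Fq →+* k)
    {q a : ℕ} (hq : 3 ≤ q) (ha : 2 ≤ a)
    (hC : ∀ c u, φ (C c) (ι u) = ι (RatFunc.C (j c) * u))
    (hX : ∀ u, φ X (ι u) =
      ι (RatFunc.X * u + u ^ a + RatFunc.X ^ (q - 1) * u ^ (q * a)))
    (f : Polynomial Fq) :
    f ≠ 0 → ∀ u : RatFunc k, u ≠ 0 → ∃ u' : RatFunc k, φ f (ι u) = ι u' ∧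
      RatFunc.inftyValuation k u ≤ RatFunc.inftyValuation k u' ∧
      (f.coeff 0 = 0 → RatFunc.inftyValuation k u < RatFunc.inftyValuation k u') := by
  induction f using Polynomial.recOnHorner with
  | M0 => exact fun h => absurd rfl h
  | MC f c hf hc ih =>
    intro _ u hu
    have hv : RatFunc.inftyValuation k (RatFunc.C (j c) * u) = RatFunc.inftyValuation k u := by
      rw [map_mul, RatFunc.inftyValuation.C k ((map_ne_zero j).2 hc), one_mul]
    by_cases h0 : f = 0
    · subst h0
      refine ⟨RatFunc.C (j c) * u, by rw [zero_add, hC], hv.ge, fun h => ?_⟩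
      simp [hc] at h
    · obtain ⟨u', hu', -, hlt⟩ := ih h0 u hu
      refine ⟨u' + RatFunc.C (j c) * u, ?_, ?_, fun h => ?_⟩
      · rw [map_add, map_add ι, ← hu', ← hC]
        rfl
      · rw [Valuation.map_add_eq_of_lt_left _ (hv.trans_lt (hlt hf))]
        exact (hlt hf).le
      · simp [hf, hc] at h
  | MX f hf ih =>
    intro _ u hu
    have hlt := inftyValuation_lt_twisted_poly hq ha hu
    obtain ⟨u', hu', hle, -⟩ := ih hf _
      ((Valuation.ne_zero_iff (RatFunc.inftyValuation k)).1 (zero_le.trans_lt hlt).ne')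
    refine ⟨u', ?_, (hlt.trans_le hle).le, fun _ => hlt.trans_le hle⟩
    rw [map_mul, ← hu', ← hX]
    rfl

/-- `E = 𝔽̄_q·F` lies in the image of the rational function field over `𝔽̄_q`. -/
lemma exists_ratFunc_hom (Fq : Type) [Field Fq] :
    ∃ ι : RatFunc (algebraicClosure Fq (Kbar Fq)) →+* Kbar Fq,
      (∀ c : Fq, ι (RatFunc.C (algebraMap Fq _ c)) =
        algebraMap (RatFunc Fq) (Kbar Fq) (RatFunc.C c)) ∧
      ι RatFunc.X = algebraMap (RatFunc Fq) (Kbar Fq) RatFunc.X ∧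
      ∀ w ∈ constFieldExt Fq, ∃ u, ι u = w := by
  set T : Kbar Fq := algebraMap (RatFunc Fq) (Kbar Fq) RatFunc.X with hT
  have hTF : Transcendental Fq T :=
    (transcendental_algebraMap_iff (algebraMap (RatFunc Fq) (Kbar Fq)).injective).2
      RatFunc.transcendental_X
  have hTk : Transcendental (algebraicClosure Fq (Kbar Fq)) T := hTF.algebraicClosure
  have hinj := transcendental_iff_injective.1 hTk
  let ev : (algebraicClosure Fq (Kbar Fq))[X] →+* Kbar Fq := (aeval T).toRingHom
  have hev := nonZeroDivisors_le_comap_nonZeroDivisors_of_injective ev hinj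
  let ι := RatFunc.liftRingHom ev hev
  have hιC (c : algebraicClosure Fq (Kbar Fq)) : ι (RatFunc.C c) = c :=
    (RatFunc.liftRingHom_C ev hev c).trans (aeval_C T c)
  have hιX : ι RatFunc.X = T := (RatFunc.liftRingHom_X ev hev).trans (aeval_X T)
  have hιF (c : Fq) : ι (RatFunc.C (algebraMap Fq _ c)) =
      algebraMap (RatFunc Fq) (Kbar Fq) (RatFunc.C c) := by
    rw [hιC, ← RatFunc.algebraMap_eq_C, ← IsScalarTower.algebraMap_apply]
    rfl
  refine ⟨ι, hιF, hιX, fun w hw => ?_⟩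
  have hpoly (f : Fq[X]) :
      algebraMap (RatFunc Fq) (Kbar Fq) (algebraMap Fq[X] (RatFunc Fq) f) ∈ ι.fieldRange := by
    induction f using Polynomial.induction_on' with
    | add f g hf hg =>
      rw [map_add, map_add]
      exact add_mem hf hg
    | monomial n c =>
      rw [← C_mul_X_pow_eq_monomial, map_mul, map_pow, RatFunc.algebraMap_C,
        RatFunc.algebraMap_X, map_mul, map_pow]
      exact mul_mem (RingHom.mem_fieldRange.2 ⟨_, hιF c⟩)
        (pow_mem (RingHom.mem_fieldRange.2 ⟨_, hιX⟩) n)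
  let M : IntermediateField (RatFunc Fq) (Kbar Fq) :=
    { ι.fieldRange with
      algebraMap_mem' := fun g => by
        rw [← RatFunc.num_div_denom g, map_div₀]
        exact div_mem (hpoly _) (hpoly _) }
  have hM : constFieldExt Fq ≤ M :=
    IntermediateField.adjoin_le_iff.2 fun x hx => ⟨RatFunc.C ⟨x, hx.isIntegral⟩, hιC _⟩
  exact hM hw

/-- Assume `p > r!`. For `𝔩 = (l) ≠ (T)`, the torsion meets the constant field extension
trivially: `φ_l(w) ≠ 0` for every nonzero `w ∈ E = 𝔽̄_q·F`. In particular, for every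
nonzero Galois-stable subspace `X ⊆ φ[𝔩]` the extension `𝔽̄_q·F(X)/𝔽̄_q·F` is
nontrivial, i.e. `X ⊄ E`. -/
theorem torsion_meets_constant_field_trivially
    (p e q r : ℕ) (hp : p.Prime) (hp5 : 5 ≤ p) (he : 0 < e) (hq : q = p ^ e)
    (hr : r.Prime) (hr3 : 3 ≤ r) (hfac : r.factorial < p)
    (Fq : Type) [Field Fq] [Fintype Fq] (hFq : Fintype.card Fq = q)
    (φ : Polynomial Fq →+* AddMonoid.End (Kbar Fq)) (hφ : IsDrinfeldPhi Fq q r φ)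
    (l : Polynomial Fq) (hlm : l.Monic) (hl : Irreducible l) (hlX : l ≠ X) :
    (∀ w : Kbar Fq, w ∈ constFieldExt Fq → w ≠ 0 → φ l w ≠ 0) ∧
    (∀ V : Set (Kbar Fq), IsGaloisStableSubspace Fq φ l V → V ≠ {0} →
      ¬ (V ⊆ (constFieldExt Fq : Set (Kbar Fq)))) := by
  classical
  have h2 : 2 ≤ q ^ (r - 1) := by
    have : 2 ≤ q := by
      rw [← hFq]
      exact Fintype.one_lt_card
    exact this.trans (Nat.le_self_pow (by omega) q)
  have hq3 : 3 ≤ q := by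
    rw [hq]
    exact (by omega : 3 ≤ p).trans (Nat.le_self_pow he.ne' p)
  have hpow : q ^ r = q * q ^ (r - 1) := by
    rw [← pow_succ']
    congr 1
    omega
  obtain ⟨ι, hιC, hιX, hιE⟩ := exists_ratFunc_hom Fq
  have main : ∀ w : Kbar Fq, w ∈ constFieldExt Fq → w ≠ 0 → φ l w ≠ 0 := by
    intro w hw hw0
    obtain ⟨u, rfl⟩ := hιE w hw
    have hu : u ≠ 0 := by
      rintro rfl
      exact hw0 (map_zero ι)
    obtain ⟨u', hu', hle, -⟩ := exists_apply_eq_inftyValuation_le φ ι (algebraMap Fq _) hq3 h2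
      (fun c u => by rw [hφ.1, map_mul, hιC])
      (fun u => by simp only [hφ.2, map_add, map_mul, map_pow, hιX, hpow]) l hl.ne_zero u hu
    rw [hu', _root_.map_ne_zero]
    rintro rfl
    rw [map_zero, le_zero_iff, Valuation.zero_iff] at hle
    exact hu hle
  refine ⟨main, fun V hV hV0 hVE => hV0 ?_⟩
  refine Set.eq_singleton_iff_unique_mem.2 ⟨hV.2.1, fun x hx => ?_⟩
  by_contra hx0
  exact main x (hVE hx) hx0 (hV.1 hx)
end
end

section
/- Let q = p^e be a prime power with p ≥ 5 and q ≡ 1 (mod r), where r ≥ 3 is a prime number, let A = 𝔽_q[T], let 𝔩 be a nonzero prime ideal of A, and let A_𝔩 = lim_n A/𝔩^n be the 𝔩-adic completion of A. Define N = {B ∈ SL_r(A_𝔩) : the reduction of B modulo 𝔩 equals δ·I_r for some δ ∈ A/𝔩 with δ^r = 1}. Then N is a normal subgroup of SL_r(A_𝔩), the quotient SL_r(A_𝔩)/N is a nontrivial simple group, and N is the unique such subgroup: every normal subgroup N′ of SL_r(A_𝔩) for which SL_r(A_𝔩)/N′ is a nontrivial simple group satisfies N′ = N. -/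
open Polynomial
set_option synthInstance.maxHeartbeats 1000000
set_option maxHeartbeats 1000000

noncomputable section

/-- Reduction modulo `𝔩`: the canonical ring homomorphism from the `𝔩`-adic completion
`A_𝔩 = lim_n A/𝔩^n` to the residue field `A/𝔩`. -/
def redMod (Fq : Type) [Field Fq] (𝔩 : Ideal (Polynomial Fq)) :
    AdicCompletion 𝔩 (Polynomial Fq) →+* Polynomial Fq ⧸ 𝔩 :=
  ((Ideal.quotientEquivAlgOfEq (Polynomial Fq) (pow_one 𝔩)).toAlgHom.comp
    (AdicCompletion.evalₐ 𝔩 1)).toRingHom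

namespace Matrix.SpecialLinearGroup

variable {n R : Type*} [Fintype n] [DecidableEq n] [CommRing R]

lemma transvection_mul_apply {i j : n} (hij : i ≠ j) (c : R) (M : SpecialLinearGroup n R)
    (k l : n) :
    (transvection hij c * M : SpecialLinearGroup n R) k l =
      M k l + if k = i then c * M j l else 0 := by
  rw [coe_mul]
  change (Matrix.transvection i j c * (M : Matrix n n R)) k l = _
  split_ifs with h
  · subst h; simp
  · simp [h]

lemma mul_transvection_apply {i j : n} (hij : i ≠ j) (c : R) (M : SpecialLinearGroup n R)
    (k l : n) :
    (M * transvection hij c : SpecialLinearGroup n R) k l =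
      M k l + if l = j then c * M k i else 0 := by
  rw [coe_mul]
  change ((M : Matrix n n R) * Matrix.transvection i j c) k l = _
  split_ifs with h
  · subst h; simp
  · simp [h]

/-- The element `1 + w · e_aᵀ` of `SL n R`, where `w` has vanishing `a`-th entry. Multiplying by
it on the left adds `w k` times the `a`-th row to the `k`-th row, for every `k`. -/
def colTransvection (a : n) (w : n → R) (hw : w a = 0) : SpecialLinearGroup n R :=
  ⟨1 + vecMulVec w (Pi.single a 1), by
    have h : (1 + vecMulVec w (Pi.single a 1) : Matrix n n R) =
        updateCol 1 a (w + Pi.single a 1) := by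
      ext i j
      by_cases hj : j = a
      · subst hj
        simp [vecMulVec_apply, one_apply, Pi.single_apply, add_comm]
      · simp [vecMulVec_apply, hj]
    rw [h, ← cramer_apply, cramer_one]
    simp [hw]⟩

lemma colTransvection_mul_apply (a : n) (w : n → R) (hw : w a = 0) (M : SpecialLinearGroup n R)
    (k l : n) :
    (colTransvection a w hw * M : SpecialLinearGroup n R) k l = M k l + w k * M a l := by
  rw [coe_mul]
  change ((1 + vecMulVec w (Pi.single a 1)) * (M : Matrix n n R)) k l = _
  simp [add_mul, vecMulVec_mul, vecMulVec_apply]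

lemma mul_colTransvection_apply_of_ne (a : n) (w : n → R) (hw : w a = 0)
    (M : SpecialLinearGroup n R) (k : n) {l : n} (hl : l ≠ a) :
    (M * colTransvection a w hw : SpecialLinearGroup n R) k l = M k l := by
  rw [coe_mul]
  change ((M : Matrix n n R) * (1 + vecMulVec w (Pi.single a 1))) k l = _
  simp [mul_add, mul_vecMulVec, vecMulVec_apply, hl]

lemma colTransvection_inv (a : n) (w : n → R) (hw : w a = 0) :
    (colTransvection a w hw)⁻¹ = colTransvection a (-w) (by simp [hw]) := by
  refine inv_eq_of_mul_eq_one_left (Subtype.ext ?_)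
  ext k l
  rw [colTransvection_mul_apply]
  have h (v : n → R) (hv : v a = 0) (i : n) :
      (colTransvection a v hv) i l = (1 : Matrix n n R) i l + v i * (1 : Matrix n n R) a l := by
    simpa using colTransvection_mul_apply a v hv 1 i l
  simp [h, hw]

/-- A subgroup containing every transvection contains every `1 + w · e_aᵀ`. -/
lemma colTransvection_mem {H : Subgroup (SpecialLinearGroup n R)}
    (hH : ∀ (i j : n) (hij : i ≠ j) (c : R), transvection hij c ∈ H)
    (a : n) (w : n → R) (hw : w a = 0) : colTransvection a w hw ∈ H := by
  suffices h : ∀ s : Finset n, ∃ g ∈ H, ∀ k l, g k l =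
      (1 : Matrix n n R) k l + if k ∈ s then w k * (1 : Matrix n n R) a l else 0 by
    obtain ⟨g, hg, h⟩ := h Finset.univ
    convert hg
    ext k l
    simpa [h] using colTransvection_mul_apply a w hw 1 k l
  intro s
  induction s using Finset.induction_on with
  | empty => exact ⟨1, H.one_mem, by simp⟩
  | insert b s hb ih =>
    obtain ⟨g, hg, h⟩ := ih
    by_cases hba : b = a
    · subst hba
      refine ⟨g, hg, fun k l ↦ ?_⟩
      by_cases hk : k = b
      · subst hk; simp [h, hb, hw]
      · simp [h, hk]
    · refine ⟨transvection hba (w b) * g, H.mul_mem (hH _ _ _ _) hg, fun k l ↦ ?_⟩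
      rw [transvection_mul_apply]
      have ha : g a l = (1 : Matrix n n R) a l := by simp [h, hw]
      by_cases hk : k = b
      · subst hk; simp [h, hb, hw]
      · simp [h, hk]

section IsLocalRing

variable [IsLocalRing R]

/-- If the columns of `M` indexed by `s` are standard and `a ∉ s`, then column `a` has a unit
entry outside the rows in `s`. -/
lemma exists_isUnit_apply_of_forall_mem {M : SpecialLinearGroup n R} {s : Finset n} {a : n}
    (ha : a ∉ s) (hM : ∀ j ∈ s, ∀ i, M i j = (1 : Matrix n n R) i j) :
    ∃ i ∉ s, IsUnit (M i a) := by
  have h (l : n) : ∑ i, M⁻¹ a i * M i l = (1 : Matrix n n R) a l := by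
    rw [← Matrix.mul_apply, ← coe_mul, inv_mul_cancel, coe_one]
  have hz : ∀ j ∈ s, M⁻¹ a j = 0 := fun j hj ↦ by
    have := h j
    simp only [hM j hj] at this
    simpa [Matrix.one_apply, show a ≠ j from fun h ↦ ha (h ▸ hj)] using this
  have hu : IsUnit (∑ i, M⁻¹ a i * M i a) := by rw [h]; simp
  obtain ⟨i, -, hi⟩ := IsLocalRing.exists_of_isUnit_sum hu
  refine ⟨i, fun his ↦ ?_, isUnit_of_mul_isUnit_right hi⟩
  simp [hz i his] at hi

lemma exists_mem_mul_apply_self_eq_one {H : Subgroup (SpecialLinearGroup n R)}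
    (hH : ∀ (i j : n) (hij : i ≠ j) (c : R), transvection hij c ∈ H)
    {M : SpecialLinearGroup n R} {s : Finset n} {a : n}
    (ha : a ∉ s) (hM : ∀ j ∈ s, ∀ i, M i j = (1 : Matrix n n R) i j) :
    ∃ h ∈ H, (∀ j ∈ s, ∀ i, (h * M) i j = (1 : Matrix n n R) i j) ∧ (h * M) a a = 1 := by
  have keep {N : SpecialLinearGroup n R} (hN : ∀ j ∈ s, ∀ i, N i j = (1 : Matrix n n R) i j)
      {k l : n} (hkl : k ≠ l) (hl : l ∉ s) (c : R) :
      ∀ j ∈ s, ∀ i, (transvection hkl c * N) i j = (1 : Matrix n n R) i j := fun j hj i ↦ by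
    simp [transvection_mul_apply, hN j hj, Matrix.one_apply,
      show l ≠ j from fun h ↦ hl (h ▸ hj)]
  have off {N : SpecialLinearGroup n R} (hN : ∀ j ∈ s, ∀ i, N i j = (1 : Matrix n n R) i j)
      {b : n} (hab : a ≠ b) (hb : b ∉ s) (hu : IsUnit (N b a)) :
      ∃ h ∈ H, (∀ j ∈ s, ∀ i, (h * N) i j = (1 : Matrix n n R) i j) ∧ (h * N) a a = 1 := by
    obtain ⟨v, hv⟩ := hu.exists_left_inv
    refine ⟨_, hH a b hab ((1 - N a a) * v), keep hN hab hb _, ?_⟩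
    simp [transvection_mul_apply, mul_assoc, hv]
  obtain ⟨i, his, hi⟩ := exists_isUnit_apply_of_forall_mem ha hM
  by_cases hia : i = a
  · subst hia
    by_cases hb : ∃ b, b ∉ s ∧ i ≠ b
    · obtain ⟨b, hb, hib⟩ := hb
      obtain ⟨v, hv⟩ := hi.exists_left_inv
      have hN := keep hM hib.symm his ((1 - M b i) * v)
      obtain ⟨h, hh, h1, h2⟩ := off hN hib hb
        (by simp [transvection_mul_apply, mul_assoc, hv])
      refine ⟨h * transvection hib.symm ((1 - M b i) * v), H.mul_mem hh (hH _ _ _ _), ?_, ?_⟩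
      · simpa only [mul_assoc] using h1
      · simpa only [mul_assoc] using h2
    · push Not at hb
      refine ⟨1, H.one_mem, by simpa using hM, ?_⟩
      have hMi : (M : Matrix n n R) = updateCol 1 i (fun k ↦ M k i) := by
        ext k l
        by_cases hl : l = i
        · subst hl; simp
        · rw [hM l (by by_contra h; exact hl (hb l h).symm)]
          simp [hl]
      have hdet := M.det_coe
      rw [hMi, ← cramer_apply, cramer_one] at hdet
      simpa using hdet
  · exact off hM (Ne.symm hia) his hi

/-- Over a local ring, `SL n R` is generated by transvections. -/
theorem eq_top_of_forall_transvection_mem {H : Subgroup (SpecialLinearGroup n R)}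
    (hH : ∀ (i j : n) (hij : i ≠ j) (c : R), transvection hij c ∈ H) : H = ⊤ := by
  refine eq_top_iff.2 fun M _ ↦ ?_
  suffices h : ∀ s : Finset n, ∃ h ∈ H, ∀ j ∈ s, ∀ i, (h * M) i j = (1 : Matrix n n R) i j by
    obtain ⟨h, hh, h1⟩ := h Finset.univ
    have : h * M = 1 := Subtype.ext (by ext i j; exact h1 j (Finset.mem_univ _) i)
    rw [eq_inv_of_mul_eq_one_right this]
    exact H.inv_mem hh
  intro s
  induction s using Finset.induction_on with
  | empty => exact ⟨1, H.one_mem, by simp⟩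
  | insert a s ha ih =>
    obtain ⟨h, hh, h1⟩ := ih
    obtain ⟨h', hh', h2, h3⟩ := exists_mem_mul_apply_self_eq_one hH ha h1
    let w : n → R := fun k ↦ if k = a then 0 else -(h' * (h * M)) k a
    have hw : w a = 0 := by simp [w]
    refine ⟨colTransvection a w hw * (h' * h),
      H.mul_mem (colTransvection_mem hH a w hw) (H.mul_mem hh' hh), fun j hj i ↦ ?_⟩
    rw [mul_assoc, mul_assoc, colTransvection_mul_apply]
    rcases Finset.mem_insert.1 hj with rfl | hj
    · by_cases hi : i = j
      · subst hi; simp only [h3, hw]; simp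
      · simp only [h3]; simp [w, hi]
    · simp only [h2 j hj]
      simp [show a ≠ j from fun h ↦ ha (h ▸ hj)]

end IsLocalRing

/-- A normal subgroup of `SL n R` containing all `1 + c · E_{i,l}` for one pair `i ≠ l`
contains every transvection. -/
lemma forall_transvection_mem_of_normal {H : Subgroup (SpecialLinearGroup n R)} (hH : H.Normal)
    (hn : 3 ≤ Fintype.card n) {i l : n} (hil : i ≠ l) (h : ∀ c : R, transvection hil c ∈ H)
    (k m : n) (hkm : k ≠ m) (c : R) : transvection hkm c ∈ H := by
  have comm {x y z : SpecialLinearGroup n R} (hxyz : x * y = z * y * x) :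
      (x ∈ H → z ∈ H) ∧ (y ∈ H → z ∈ H) := by
    have hz : z = x * y * x⁻¹ * y⁻¹ := by rw [hxyz]; group
    refine ⟨fun hx ↦ ?_, fun hy ↦ ?_⟩
    · rw [hz, mul_assoc, mul_assoc, ← mul_assoc y]
      exact H.mul_mem hx (hH.conj_mem _ (H.inv_mem hx) y)
    · rw [hz]
      exact H.mul_mem (hH.conj_mem _ hy x) (H.inv_mem hy)
  have key {a b d : n} (hab : a ≠ b) (hbd : b ≠ d) (had : a ≠ d) (c c' : R) :
      transvection hab c * transvection hbd c' =
        transvection had (c * c') * transvection hbd c' * transvection hab c := by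
    refine Subtype.ext ?_
    simp only [coe_mul, transvection_coe, mul_add, add_mul, one_mul, mul_one,
      single_mul_single_same, single_mul_single_of_ne _ _ _ _ hbd.symm,
      single_mul_single_of_ne _ _ _ _ had.symm, add_zero]
    abel
  have row {a b d : n} (hab : a ≠ b) (had : a ≠ d) (h : ∀ c : R, transvection hab c ∈ H) (c : R) :
      transvection had c ∈ H := by
    by_cases hbd : b = d
    · subst hbd; exact h c
    · simpa using (comm (key hab hbd had c 1)).1 (h c)
  have col {a b d : n} (hbd : b ≠ d) (had : a ≠ d) (h : ∀ c : R, transvection hbd c ∈ H) (c : R) :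
      transvection had c ∈ H := by
    by_cases hab : a = b
    · subst hab; exact h c
    · simpa using (comm (key hab hbd had 1 c)).2 (h c)
  obtain ⟨s, hs⟩ : ∃ s, s ∉ ({i, k} : Finset n) := by
    by_contra! hs
    have := Finset.card_le_card (fun x _ ↦ hs x : (Finset.univ : Finset n) ⊆ _)
    have h2 := Finset.card_le_two (a := i) (b := k)
    rw [Finset.card_univ] at this
    omega
  simp only [Finset.mem_insert, Finset.mem_singleton, not_or] at hs
  exact row (Ne.symm hs.2) hkm (col (Ne.symm hs.1) (Ne.symm hs.2) (row hil (Ne.symm hs.1) h)) c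

/-- A normal subgroup of `SL n R`, `n ≥ 3`, having an element with a unit off-diagonal entry
contains every transvection. -/
lemma forall_transvection_mem_of_isUnit_apply {H : Subgroup (SpecialLinearGroup n R)}
    (hH : H.Normal) (hn : 3 ≤ Fintype.card n) {g : SpecialLinearGroup n R} (hg : g ∈ H)
    {i j : n} (hij : i ≠ j) (hu : IsUnit (g i j))
    (k m : n) (hkm : k ≠ m) (c : R) : transvection hkm c ∈ H := by
  wlog hcol : ∀ k, k ≠ i → g k j = 0 generalizing g
  · obtain ⟨v, hv⟩ := hu.exists_right_inv
    let w : n → R := fun k ↦ if k = i then 0 else -g k j * v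
    have hw : w i = 0 := by simp [w]
    have hent (k : n) :
        (colTransvection i w hw * g * (colTransvection i w hw)⁻¹) k j =
          g k j + w k * g i j := by
      rw [colTransvection_inv, mul_colTransvection_apply_of_ne _ _ _ _ _ hij.symm,
        colTransvection_mul_apply]
    refine this (hH.conj_mem g hg (colTransvection i w hw)) (by simpa [hent, hw] using hu)
      fun k hk ↦ ?_
    rw [hent]
    simp only [w, if_neg hk]
    linear_combination -g k j * hv
  obtain ⟨l, hl⟩ : ∃ l, l ∉ ({i, j} : Finset n) := by
    by_contra! hs
    have := Finset.card_le_card (fun x _ ↦ hs x : (Finset.univ : Finset n) ⊆ _)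
    have h2 := Finset.card_le_two (a := i) (b := j)
    rw [Finset.card_univ] at this
    omega
  simp only [Finset.mem_insert, Finset.mem_singleton, not_or] at hl
  obtain ⟨hli, hlj⟩ := hl
  set x : SpecialLinearGroup n R := transvection (Ne.symm hlj) 1 with hx
  set h : SpecialLinearGroup n R := g * x * g⁻¹ * x⁻¹ with hh
  have hhH : h ∈ H := by
    rw [hh, mul_assoc, mul_assoc, ← mul_assoc x]
    exact H.mul_mem hg (hH.conj_mem _ (H.inv_mem hg) x)
  have hinv (a b : n) : ∑ k, g a k * g⁻¹ k b = (1 : Matrix n n R) a b := by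
    rw [← Matrix.mul_apply, ← coe_mul, mul_inv_cancel, coe_one]
  have hinv' (a b : n) : ∑ k, g⁻¹ a k * g k b = (1 : Matrix n n R) a b := by
    rw [← Matrix.mul_apply, ← coe_mul, inv_mul_cancel, coe_one]
  have hconj (a b : n) :
      (g * x * g⁻¹) a b = (1 : Matrix n n R) a b + g a j * g⁻¹ l b := by
    rw [coe_mul, Matrix.mul_apply]
    simp only [hx, mul_transvection_apply, add_mul, Finset.sum_add_distrib, hinv, one_mul,
      ite_mul, zero_mul, Finset.sum_ite_eq', Finset.mem_univ, if_true]
  have hli0 : g⁻¹ l i = 0 := by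
    have := hinv' l j
    rw [Finset.sum_eq_single i (fun k _ hk ↦ by rw [hcol k hk, mul_zero]) (by simp)] at this
    rw [Matrix.one_apply_ne hlj] at this
    exact (hu.mul_left_eq_zero).1 this
  have hent (a b : n) : h a b = (1 : Matrix n n R) a b + g a j * g⁻¹ l b -
      if b = l then ((1 : Matrix n n R) a j + g a j * g⁻¹ l j) else 0 := by
    rw [hh, hx, transvection_inv, mul_transvection_apply, ← hx, hconj, hconj]
    split_ifs <;> ring
  refine forall_transvection_mem_of_normal hH hn (Ne.symm hli) (fun c ↦ ?_) k m hkm c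
  have key : h * transvection hij c =
      transvection (Ne.symm hli) c * (transvection hij c * h) := by
    refine Subtype.ext ?_
    ext a b
    rw [mul_transvection_apply, transvection_mul_apply, transvection_mul_apply,
      transvection_mul_apply, if_neg hli]
    simp only [hent, hcol l hli, hcol j hij.symm, hli0, if_neg (Ne.symm hli)]
    simp only [Matrix.one_apply]
    grind
  have : transvection (Ne.symm hli) c =
      h * (transvection hij c * h⁻¹ * (transvection hij c)⁻¹) := by
    rw [← mul_assoc, ← mul_assoc, key]; group
  rw [this]
  exact H.mul_mem hhH (hH.conj_mem _ (H.inv_mem hhH) _)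

/-- A normal subgroup of `SL n R`, with `R` local and `n ≥ 3`, which has an element that is not
scalar modulo the maximal ideal is everything. -/
theorem eq_top_of_normal_of_map_ne_smul_one [IsLocalRing R] {k : Type*} [CommRing k]
    (f : R →+* k) (hf : ∀ x, f x ≠ 0 → IsUnit x)
    {H : Subgroup (SpecialLinearGroup n R)} (hH : H.Normal) (hn : 3 ≤ Fintype.card n)
    {g : SpecialLinearGroup n R} (hg : g ∈ H)
    (hs : ∀ δ : k, (map f g : Matrix n n k) ≠ δ • 1) : H = ⊤ := by
  refine eq_top_of_forall_transvection_mem ?_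
  suffices ∃ g ∈ H, ∃ i j, i ≠ j ∧ f (g i j) ≠ 0 by
    obtain ⟨g, hg, i, j, hij, hu⟩ := this
    exact forall_transvection_mem_of_isUnit_apply hH hn hg hij (hf _ hu)
  by_contra! h0
  have hdiag (i j : n) : f (g i i) = f (g j j) := by
    by_cases hij : i = j
    · rw [hij]
    have h1 := h0 _ (hH.conj_mem g hg (transvection hij 1)) i j hij
    rw [transvection_inv, mul_transvection_apply] at h1
    simp only [transvection_mul_apply, if_true, map_add, map_mul, map_neg, map_one,
      h0 g hg i j hij, h0 g hg j i (Ne.symm hij)] at h1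
    linear_combination -h1
  have : Nonempty n := Fintype.card_pos_iff.1 (by omega)
  obtain ⟨a⟩ := this
  refine hs (f (g a a)) ?_
  ext i j
  rw [map_apply_coe, RingHom.mapMatrix_apply, Matrix.map_apply, Matrix.smul_apply]
  by_cases hij : i = j
  · subst hij; simp [hdiag i a]
  · simp [hij, h0 g hg i j hij]

end Matrix.SpecialLinearGroup

/-- If every normal subgroup of `G` is contained in `N` or equal to `G`, and `N ≠ G` is normal,
then `N` is the unique normal subgroup with simple quotient. -/
lemma Subgroup.isSimpleGroup_quotient_iff_eq {G : Type*} [Group G] {N : Subgroup G}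
    [hN : N.Normal] (hN1 : N ≠ ⊤) (h : ∀ H : Subgroup G, H.Normal → H ≤ N ∨ H = ⊤)
    (N' : Subgroup G) [N'.Normal] : IsSimpleGroup (G ⧸ N') ↔ N' = N := by
  constructor
  · intro hs
    have hle : N' ≤ N := (h N' inferInstance).resolve_right fun ht ↦
      not_subsingleton (G ⧸ N') (QuotientGroup.subsingleton_iff.2 ht)
    have hnm : (N.map (QuotientGroup.mk' N')).Normal :=
      hN.map _ (QuotientGroup.mk'_surjective N')
    have hcm : (N.map (QuotientGroup.mk' N')).comap (QuotientGroup.mk' N') = N := by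
      rw [Subgroup.comap_map_eq, QuotientGroup.ker_mk', sup_eq_left.2 hle]
    rcases hnm.eq_bot_or_eq_top with hb | ht
    · rw [hb, MonoidHom.comap_bot, QuotientGroup.ker_mk'] at hcm
      exact hcm
    · rw [ht, Subgroup.comap_top] at hcm
      exact absurd hcm.symm hN1
  · rintro rfl
    have : Nontrivial (G ⧸ N') := QuotientGroup.nontrivial_iff.2 hN1
    refine ⟨fun H hH ↦ ?_⟩
    have hsurj := QuotientGroup.mk'_surjective N'
    rcases h (H.comap (QuotientGroup.mk' N')) inferInstance with hle | ht
    · left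
      rw [← Subgroup.map_comap_eq_self_of_surjective hsurj H, Subgroup.map_eq_bot_iff,
        QuotientGroup.ker_mk']
      exact hle
    · right
      rw [← Subgroup.map_comap_eq_self_of_surjective hsurj H, ht,
        Subgroup.map_top_of_surjective _ hsurj]

lemma AdicCompletion.isLocalRing_of_isMaximal {R : Type*} [CommRing R] (m : Ideal R) [m.IsMaximal]
    (fg : m.FG) : IsLocalRing (AdicCompletion m R) := by
  have := AdicCompletion.isMaximal_map_of_le _ _ (le_refl m) fg
  have := AdicCompletion.isAdicComplete_self _ fg
  exact isLocalRing_of_isAdicComplete_maximal (m.map (algebraMap R (AdicCompletion m R)))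

lemma redMod_surjective (Fq : Type) [Field Fq] (𝔩 : Ideal (Polynomial Fq)) :
    Function.Surjective (redMod Fq 𝔩) :=
  (Ideal.quotientEquivAlgOfEq (Polynomial Fq) (pow_one 𝔩)).surjective.comp
    (AdicCompletion.surjective_evalₐ 𝔩 1)

/-- For `A = 𝔽_q[T]` with `q = p^e ≡ 1 (mod r)`, `p ≥ 5`, `r ≥ 3` prime, and `𝔩` a
nonzero prime of `A`: the subgroup
`N = {B ∈ SL_r(A_𝔩) : B ≡ δ·I mod 𝔩 for some δ ∈ A/𝔩 with δ^r = 1}` is normal,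
`SL_r(A_𝔩)/N` is a (nontrivial) simple group, and `N` is the unique normal subgroup of
`SL_r(A_𝔩)` with simple quotient. -/
theorem SL_adicCompletion_unique_normal_with_simple_quotient
    (p e q r : ℕ) (hp : p.Prime) (hp5 : 5 ≤ p) (he : 0 < e) (hq : q = p ^ e)
    (hr : r.Prime) (hr3 : 3 ≤ r) (hqr : q % r = 1)
    (Fq : Type) [Field Fq] [Fintype Fq] (hFq : Fintype.card Fq = q)
    (𝔩 : Ideal (Polynomial Fq)) (h𝔩 : 𝔩.IsPrime) (h𝔩0 : 𝔩 ≠ ⊥)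
    (N : Subgroup (Matrix.SpecialLinearGroup (Fin r) (AdicCompletion 𝔩 (Polynomial Fq))))
    (hN : ∀ B : Matrix.SpecialLinearGroup (Fin r) (AdicCompletion 𝔩 (Polynomial Fq)),
      B ∈ N ↔ ∃ δ : Polynomial Fq ⧸ 𝔩, δ ^ r = 1 ∧
        ((Matrix.SpecialLinearGroup.map (redMod Fq 𝔩) B :
            Matrix.SpecialLinearGroup (Fin r) (Polynomial Fq ⧸ 𝔩)) :
          Matrix (Fin r) (Fin r) (Polynomial Fq ⧸ 𝔩)) =
          δ • (1 : Matrix (Fin r) (Fin r) (Polynomial Fq ⧸ 𝔩))) :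
    N.Normal ∧
    (∀ _ : N.Normal,
      IsSimpleGroup ((Matrix.SpecialLinearGroup (Fin r) (AdicCompletion 𝔩 (Polynomial Fq))) ⧸ N)) ∧
    (∀ (N' : Subgroup (Matrix.SpecialLinearGroup (Fin r) (AdicCompletion 𝔩 (Polynomial Fq))))
      (_ : N'.Normal),
      IsSimpleGroup ((Matrix.SpecialLinearGroup (Fin r) (AdicCompletion 𝔩 (Polynomial Fq))) ⧸ N') →
      N' = N) := by
  have hmax : 𝔩.IsMaximal := h𝔩.isMaximal h𝔩0
  let : Field (Polynomial Fq ⧸ 𝔩) := Ideal.Quotient.field 𝔩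
  have : IsLocalRing (AdicCompletion 𝔩 (Polynomial Fq)) :=
    AdicCompletion.isLocalRing_of_isMaximal 𝔩 (IsNoetherian.noetherian 𝔩)
  have hloc : IsLocalHom (redMod Fq 𝔩) := (redMod_surjective Fq 𝔩).isLocalHom
  have hunit : ∀ x, redMod Fq 𝔩 x ≠ 0 → IsUnit x := fun x hx ↦
    isUnit_of_map_unit (redMod Fq 𝔩) x hx.isUnit
  have hcard : 3 ≤ Fintype.card (Fin r) := by simpa using hr3
  have hnorm : N.Normal := by
    refine ⟨fun B hB g ↦ (hN _).2 ?_⟩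
    obtain ⟨δ, hδ, h⟩ := (hN B).1 hB
    refine ⟨δ, hδ, ?_⟩
    rw [map_mul, map_mul, Matrix.SpecialLinearGroup.coe_mul, Matrix.SpecialLinearGroup.coe_mul, h,
      mul_smul_comm, mul_one, smul_mul_assoc, ← Matrix.SpecialLinearGroup.coe_mul, ← map_mul,
      mul_inv_cancel, map_one, Matrix.SpecialLinearGroup.coe_one]
  have hne : N ≠ ⊤ := by
    have h01 : (⟨0, by omega⟩ : Fin r) ≠ ⟨1, by omega⟩ := by simp
    intro htop
    obtain ⟨δ, -, h⟩ := (hN (Matrix.SpecialLinearGroup.transvection h01 1)).1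
      (htop ▸ Subgroup.mem_top _)
    have := congr_fun (congr_fun h ⟨0, by omega⟩) ⟨1, by omega⟩
    simp [Matrix.SpecialLinearGroup.transvection_coe, h01] at this
  have hle : ∀ H : Subgroup (Matrix.SpecialLinearGroup (Fin r)
      (AdicCompletion 𝔩 (Polynomial Fq))), H.Normal → H ≤ N ∨ H = ⊤ := by
    intro H hH
    by_contra! hcon
    obtain ⟨B, hB, hBN⟩ := SetLike.not_le_iff_exists.1 hcon.1
    refine hcon.2 (Matrix.SpecialLinearGroup.eq_top_of_normal_of_map_ne_smul_one
      (redMod Fq 𝔩) hunit hH hcard hB fun δ hδ ↦ hBN ((hN B).2 ⟨δ, ?_, hδ⟩))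
    have hdet := (Matrix.SpecialLinearGroup.map (redMod Fq 𝔩) B).det_coe
    rw [hδ] at hdet
    simpa using hdet
  exact ⟨hnorm, fun _ ↦ (Subgroup.isSimpleGroup_quotient_iff_eq hne hle N).2 rfl,
    fun N' _ ↦ (Subgroup.isSimpleGroup_quotient_iff_eq hne hle N').1⟩
end
end

section
/- Let r be a prime number and let 𝔽 be a finite field with |𝔽| ≡ 1 (mod r). Then every normal subgroup of GL_r(𝔽) of order r is contained in the subgroup of scalar matrices (the center of GL_r(𝔽)). -/
/-- Elements acting trivially by conjugation on a normal subgroup commute with its elements. -/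
theorem commute_of_conjNormal_eq_one {G : Type*} [Group G] {N : Subgroup G} [N.Normal] {g x : G}
    (hg : MulAut.conjNormal (H := N) g = 1) (hx : x ∈ N) : Commute g x := by
  have h := MulAut.conjNormal_apply g (⟨x, hx⟩ : N)
  rw [hg, MulAut.one_apply] at h
  exact mul_inv_eq_iff_eq_mul.mp h.symm

/-- An element `t` with `a * b = t * (b * a)` acts trivially by conjugation on every cyclic
normal subgroup. -/
theorem conjNormal_eq_one_of_mul_eq {G : Type*} [Group G] {N : Subgroup G} [N.Normal]
    [IsCyclic N] {t a b : G} (h : a * b = t * (b * a)) :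
    MulAut.conjNormal (H := N) t = 1 := by
  have hcomm (f g : MulAut N) : f * g = g * f :=
    (IsCyclic.mulAutMulEquiv N).injective (by simp only [map_mul, mul_comm])
  have h' := congrArg (MulAut.conjNormal (H := N)) h
  rw [map_mul, map_mul, map_mul, hcomm] at h'
  exact right_eq_mul.mp h'

/-- The commutator relation between elementary matrices. -/
theorem transvection_mul_transvection_of_ne {n R : Type*} [Fintype n] [DecidableEq n]
    [CommRing R] {i j k : n} (hik : i ≠ k) (hjk : j ≠ k) (c : R) :
    Matrix.transvection i j c * Matrix.transvection j k 1 =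
      Matrix.transvection i k c * (Matrix.transvection j k 1 * Matrix.transvection i j c) := by
  simp only [Matrix.transvection, mul_add, add_mul, one_mul, mul_one,
    Matrix.single_mul_single_same, Matrix.single_mul_single_of_ne _ _ _ _ hik.symm,
    Matrix.single_mul_single_of_ne _ _ _ _ hjk.symm, Matrix.mul_zero]
  abel

/-- Let `r` be a prime and `𝔽` a finite field with `|𝔽| ≡ 1 (mod r)`. Every normal
subgroup of `GL_r(𝔽)` of order `r` is contained in the subgroup of scalar matrices. -/
theorem normal_subgroup_order_r_le_scalars
    (r : ℕ) (hr : r.Prime) (𝔽 : Type) [Field 𝔽] [Fintype 𝔽]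
    (hcard : Fintype.card 𝔽 % r = 1)
    (N : Subgroup (GL (Fin r) 𝔽)) (hN : N.Normal) (hNr : Nat.card N = r) :
    ∀ M ∈ N, ∃ δ : 𝔽, (M : Matrix (Fin r) (Fin r) 𝔽) = δ • (1 : Matrix (Fin r) (Fin r) 𝔽) := by
  intro M hM
  have : Fact r.Prime := ⟨hr⟩
  have : IsCyclic N := isCyclic_of_prime_card hNr
  suffices h : ∀ t : Matrix.TransvectionStruct (Fin r) 𝔽,
      MulAut.conjNormal (H := N) (.mk _ _ t.mul_inv t.inv_mul : GL (Fin r) 𝔽) = 1 by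
    obtain ⟨δ, hδ⟩ := Matrix.mem_range_scalar_of_commute_transvectionStruct
      (M := (M : Matrix (Fin r) (Fin r) 𝔽)) fun t ↦
        congrArg Units.val (commute_of_conjNormal_eq_one (h t) hM).eq
    exact ⟨δ, by rw [← hδ, Matrix.scalar_apply, Matrix.smul_one_eq_diagonal]⟩
  intro t
  obtain rfl | hr2 := eq_or_ne r 2
  · have hcardAut : Nat.card (MulAut N) = 1 := by
      rw [IsCyclic.card_mulAut, hNr, Nat.totient_two]
    have := (Nat.card_eq_one_iff_unique.mp hcardAut).1
    exact Subsingleton.elim _ _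
  · have h3 : 2 < r := lt_of_le_of_ne hr.two_le hr2.symm
    obtain ⟨j, hj⟩ : ∃ j, j ∉ ({t.i, t.j} : Finset (Fin r)) := by
      by_contra! h
      have := Finset.card_le_card (fun x _ ↦ h x : Finset.univ ⊆ ({t.i, t.j} : Finset (Fin r)))
      have := Finset.card_le_two (a := t.i) (b := t.j)
      simp only [Finset.card_univ, Fintype.card_fin] at *
      omega
    simp only [Finset.mem_insert, Finset.mem_singleton, not_or] at hj
    let a : Matrix.TransvectionStruct (Fin r) 𝔽 := ⟨t.i, j, Ne.symm hj.1, t.c⟩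
    let b : Matrix.TransvectionStruct (Fin r) 𝔽 := ⟨j, t.j, hj.2, 1⟩
    exact conjNormal_eq_one_of_mul_eq (a := .mk _ _ a.mul_inv a.inv_mul)
      (b := .mk _ _ b.mul_inv b.inv_mul)
      (Units.ext (transvection_mul_transvection_of_ne t.hij hj.2 t.c))
end
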